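/- arXiv:math/0402382 — 3 statements merged into one kernel-verified Lean document; each statement's English description precedes it below -/
import Mathlib

section
/- Let 0 < α < β ≤ 1 and let f : ℝ → ℂ be a 1-periodic function which is Hölder continuous of index β, with Fourier coefficients c_n = ∫₀¹ f(t) e(−nt) dt. Then ∑_{n ≠ 0} |n|^{α − 1/2} |c_n| < ∞. -/
open Complex Filter Finset

/-- `e x = exp(2 π i x)` -/
noncomputable def e (t : ℝ) : ℂ := Complex.exp (2 * Real.pi * Complex.I * t)

lemma e_add (s t : ℝ) : e (s + t) = e s * e t := by
  simp only [e, ← Complex.exp_add]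
  congr 1
  push_cast
  ring

lemma e_int (n : ℤ) : e n = 1 := by
  rw [e, Complex.exp_eq_one_iff]
  exact ⟨n, by push_cast; ring⟩

lemma continuous_e : Continuous e := by
  unfold e
  fun_prop

/-- Away from the integers, at distance at least `1 / 4`, the character `e` is far from `1`. -/
lemma two_le_norm_e_sub_one_sq {t : ℝ} (h₁ : 1 / 4 ≤ |t|) (h₂ : |t| ≤ 1 / 2) :
    2 ≤ ‖e t - 1‖ ^ 2 := by
  have he : e t = (Real.cos (2 * Real.pi * t) : ℂ) + (Real.sin (2 * Real.pi * t) : ℂ) * I := by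
    rw [Complex.ofReal_cos, Complex.ofReal_sin, ← Complex.exp_mul_I, e]
    congr 1
    push_cast
    ring
  have hcos : Real.cos (2 * Real.pi * t) ≤ 0 := by
    rw [← Real.cos_abs, abs_mul, abs_of_pos Real.two_pi_pos]
    apply Real.cos_nonpos_of_pi_div_two_le_of_le <;> nlinarith [Real.pi_pos]
  have hre : (e t - 1).re = Real.cos (2 * Real.pi * t) - 1 := by
    rw [he, Complex.sub_re, Complex.add_re, Complex.re_ofReal_mul, Complex.ofReal_re]
    simp
  have him : (e t - 1).im = Real.sin (2 * Real.pi * t) := by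
    rw [he, Complex.sub_im, Complex.add_im, Complex.im_ofReal_mul, Complex.ofReal_im]
    simp
  rw [← Complex.normSq_eq_norm_sq, Complex.normSq_apply, hre, him]
  nlinarith [Real.sin_sq_add_cos_sq (2 * Real.pi * t)]

lemma continuous_of_norm_sub_le {f : ℝ → ℂ} {C β : ℝ} (hβ : 0 < β)
    (hf : ∀ x y : ℝ, ‖f x - f y‖ ≤ C * |x - y| ^ β) : Continuous f := by
  rw [continuous_iff_continuousAt]
  intro y
  rw [ContinuousAt, tendsto_iff_norm_sub_tendsto_zero]
  refine squeeze_zero (fun _ => norm_nonneg _) (fun x => hf x y) ?_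
  have h : Continuous fun x : ℝ => C * |x - y| ^ β :=
    continuous_const.mul ((continuous_id.sub continuous_const).abs.rpow_const
      fun _ => Or.inr hβ.le)
  simpa [Real.zero_rpow hβ.ne'] using h.tendsto y

lemma integral_shift_mul_e {f : ℝ → ℂ} (hper : Function.Periodic f 1) (h : ℝ) (n : ℤ) :
    ∫ t in (0 : ℝ)..1, f (t + h) * e (-(n : ℝ) * t) =
      e (n * h) * ∫ t in (0 : ℝ)..1, f t * e (-(n : ℝ) * t) := by
  have hF : Function.Periodic (fun t => f t * e (-(n : ℝ) * t)) 1 := by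
    intro t
    have h₁ : -(n : ℝ) * (t + 1) = -(n : ℝ) * t + ((-n : ℤ) : ℝ) := by push_cast; ring
    simp only [hper t, h₁, e_add, e_int, mul_one]
  have hs : ∀ t : ℝ, f (t + h) * e (-(n : ℝ) * t) =
      e (n * h) * (f (t + h) * e (-(n : ℝ) * (t + h))) := by
    intro t
    have h₁ : -(n : ℝ) * t = n * h + -(n : ℝ) * (t + h) := by ring
    rw [h₁, e_add]
    ring
  simp_rw [hs]
  rw [intervalIntegral.integral_const_mul,
    intervalIntegral.integral_comp_add_right (fun t => f t * e (-(n : ℝ) * t)) h]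
  have := hF.intervalIntegral_add_eq h 0
  rw [zero_add, add_comm 1 h, this, zero_add]

/-- **Parseval's identity** in terms of the character `e`. -/
lemma hasSum_norm_sq_integral_mul_e {g : ℝ → ℂ} (hg : Continuous g) :
    HasSum (fun n : ℤ => ‖∫ t in (0 : ℝ)..1, g t * e (-(n : ℝ) * t)‖ ^ 2)
      (∫ t in (0 : ℝ)..1, ‖g t‖ ^ 2) := by
  have hL2 : MeasureTheory.MemLp g 2 (MeasureTheory.volume.restrict (Set.Ioc 0 1)) :=
    (MeasureTheory.memLp_two_iff_integrable_sq_norm hg.aestronglyMeasurable).2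
      (hg.norm.pow 2).integrableOn_Ioc
  convert hasSum_sq_fourierCoeffOn zero_lt_one hL2 using 1
  · funext n
    rw [fourierCoeffOn_eq_integral]
    simp only [fourier_coe_apply, e, smul_eq_mul]
    norm_num
    congr 2
    funext t
    rw [mul_comm]
    congr 2
    ring
  · simp

/-- The `L²` modulus of continuity of a Hölder function, on the Fourier side. -/
lemma summable_and_tsum_norm_e_sub_one_sq_le {f : ℝ → ℂ} (hper : Function.Periodic f 1)
    {C β : ℝ} (hβ : 0 < β)
    (hf : ∀ x y : ℝ, ‖f x - f y‖ ≤ C * |x - y| ^ β) {c : ℤ → ℂ}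
    (hc : ∀ n : ℤ, c n = ∫ t in (0 : ℝ)..1, f t * e (-(n : ℝ) * t)) (h : ℝ) :
    Summable (fun n : ℤ => ‖e (n * h) - 1‖ ^ 2 * ‖c n‖ ^ 2) ∧
      ∑' n : ℤ, ‖e (n * h) - 1‖ ^ 2 * ‖c n‖ ^ 2 ≤ (C * |h| ^ β) ^ 2 := by
  have hcont := continuous_of_norm_sub_le hβ hf
  have hg : Continuous fun t => f (t + h) - f t := by fun_prop
  have hsum : HasSum (fun n : ℤ => ‖e (n * h) - 1‖ ^ 2 * ‖c n‖ ^ 2)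
      (∫ t in (0 : ℝ)..1, ‖f (t + h) - f t‖ ^ 2) := by
    convert hasSum_norm_sq_integral_mul_e hg using 2 with n
    have hcn : Continuous fun t : ℝ => e (-(n : ℝ) * t) := continuous_e.comp (by fun_prop)
    simp_rw [sub_mul]
    have hf₁ : Continuous fun t : ℝ => f (t + h) * e (-(n : ℝ) * t) := by fun_prop
    have hf₂ : Continuous fun t : ℝ => f t * e (-(n : ℝ) * t) := by fun_prop
    rw [intervalIntegral.integral_sub (hf₁.intervalIntegrable _ _)
      (hf₂.intervalIntegrable _ _), integral_shift_mul_e hper, ← hc,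
      ← mul_pow, ← norm_mul, sub_mul, one_mul]
  refine ⟨hsum.summable, hsum.tsum_eq.trans_le ?_⟩
  calc ∫ t in (0 : ℝ)..1, ‖f (t + h) - f t‖ ^ 2
      ≤ ∫ _ in (0 : ℝ)..1, (C * |h| ^ β) ^ 2 := by
        refine intervalIntegral.integral_mono_on zero_le_one
          ((hg.norm.pow 2).intervalIntegrable _ _) intervalIntegrable_const fun t _ => ?_
        have := hf (t + h) t
        rw [add_sub_cancel_left] at this
        gcongr
    _ = (C * |h| ^ β) ^ 2 := by simp

/-- Fourier coefficients of a `β`-Hölder function satisfy the Sobolev bound of every order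
`s < β`. -/
lemma summable_abs_rpow_mul_norm_sq {f : ℝ → ℂ} (hper : Function.Periodic f 1)
    {C β s : ℝ} (hs : 0 ≤ s) (hsβ : s < β)
    (hf : ∀ x y : ℝ, ‖f x - f y‖ ≤ C * |x - y| ^ β) {c : ℤ → ℂ}
    (hc : ∀ n : ℤ, c n = ∫ t in (0 : ℝ)..1, f t * e (-(n : ℝ) * t)) :
    Summable (fun n : {n : ℤ // n ≠ 0} => (|(n.1 : ℝ)| ^ s * ‖c n.1‖) ^ 2) := by
  have hβ : 0 < β := hs.trans_lt hsβ
  set h : ℕ → ℝ := fun k => ((2 : ℝ) ^ (k + 2))⁻¹ with hh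
  have hbound := fun k => summable_and_tsum_norm_e_sub_one_sq_le hper hβ hf hc (h k)
  set r : ℝ := ((2 : ℝ) ^ (s - β)) ^ 2 with hr
  have hr1 : r < 1 := pow_lt_one₀ (by positivity)
    (Real.rpow_lt_one_of_one_lt_of_neg one_lt_two (by linarith)) two_ne_zero
  have hblock : ∀ k : ℕ, (((2 : ℝ) ^ (k + 2)) ^ s) ^ 2 * (C * |h k| ^ β) ^ 2
      = C ^ 2 * r ^ (k + 2) := by
    intro k
    have h2 : (0 : ℝ) < 2 ^ (k + 2) := by positivity
    rw [hh, hr, abs_of_pos (inv_pos.2 h2), Real.inv_rpow h2.le, ← Real.rpow_neg h2.le, ← mul_pow,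
      mul_left_comm, ← Real.rpow_add h2, ← sub_eq_add_neg, mul_pow, ← pow_mul, mul_comm 2 (k + 2),
      pow_mul, ← Real.rpow_natCast 2 (k + 2), ← Real.rpow_mul zero_le_two, mul_comm _ (s - β),
      Real.rpow_mul zero_le_two, Real.rpow_natCast]
  have hpair : Summable (fun p : ℕ × ℤ =>
      (((2 : ℝ) ^ (p.1 + 2)) ^ s) ^ 2 * (‖e (p.2 * h p.1) - 1‖ ^ 2 * ‖c p.2‖ ^ 2)) := by
    rw [summable_prod_of_nonneg fun p => by positivity]
    refine ⟨fun k => (hbound k).1.mul_left ((((2 : ℝ) ^ (k + 2)) ^ s) ^ 2), ?_⟩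
    refine Summable.of_nonneg_of_le (fun k => tsum_nonneg fun n => by positivity)
      (fun k => ?_) (((summable_nat_add_iff 2).2
        (summable_geometric_of_lt_one (by positivity) hr1)).mul_left (C ^ 2))
    simp only
    rw [tsum_mul_left, ← hblock]
    exact mul_le_mul_of_nonneg_left (hbound k).2 (by positivity)
  have hinj : Function.Injective
      (fun n : {n : ℤ // n ≠ 0} => (Nat.log 2 n.1.natAbs, n.1)) :=
    fun m n hmn => Subtype.ext (Prod.ext_iff.1 hmn).2
  refine Summable.of_nonneg_of_le (fun n => by positivity) (fun n => ?_)
    (hpair.comp_injective hinj)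
  obtain ⟨n, hn⟩ := n
  simp only [Function.comp_apply]
  set k := Nat.log 2 n.natAbs
  have habs : |(n : ℝ)| = (n.natAbs : ℝ) := by rw [Nat.cast_natAbs, Int.cast_abs]
  have hlow : (2 : ℝ) ^ k ≤ |(n : ℝ)| := by
    rw [habs]
    exact_mod_cast Nat.pow_log_le_self 2 (Int.natAbs_ne_zero.2 hn)
  have hup : |(n : ℝ)| ≤ (2 : ℝ) ^ (k + 1) := by
    rw [habs]
    exact_mod_cast (Nat.lt_pow_succ_log_self one_lt_two n.natAbs).le
  have h2 : (0 : ℝ) < 2 ^ k := by positivity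
  have hnh : |(n : ℝ) * h k| = |(n : ℝ)| / (2 ^ k * 4) := by
    have h4 : (2 : ℝ) ^ (k + 2) = 2 ^ k * 4 := by ring
    have hk4 : h k = (2 ^ k * 4)⁻¹ := congrArg _ h4
    rw [abs_mul, hk4, abs_of_pos (a := (2 ^ k * 4 : ℝ)⁻¹) (by positivity), div_eq_mul_inv]
  have hfar : 2 ≤ ‖e (n * h k) - 1‖ ^ 2 := by
    apply two_le_norm_e_sub_one_sq <;> rw [hnh]
    · rw [le_div_iff₀ (by positivity)]
      linarith
    · rw [div_le_iff₀ (by positivity)]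
      rw [pow_succ] at hup
      linarith
  rw [mul_pow]
  have hpow : |(n : ℝ)| ≤ 2 ^ (k + 2) := by
    rw [pow_succ] at hup ⊢
    rw [pow_succ]
    linarith
  have hc1 : ‖c n‖ ^ 2 ≤ ‖e (n * h k) - 1‖ ^ 2 * ‖c n‖ ^ 2 :=
    le_mul_of_one_le_left (by positivity) (by linarith)
  gcongr

/-- Second part of S. Bernstein's theorem (Corollary to Theorem 3):
if `f` is Hölder of index `β > α`, then `∑_{n ≠ 0} |n|^{α - 1/2} |c_n| < ∞`. -/
theorem stmt_6 (α β : ℝ) (hα : 0 < α) (hαβ : α < β) (hβ : β ≤ 1)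
    (f : ℝ → ℂ) (hper : Function.Periodic f 1)
    (hHolder : ∃ C > (0:ℝ), ∀ x y : ℝ, ‖f x - f y‖ ≤ C * |x - y| ^ β)
    (c : ℤ → ℂ)
    (hc : ∀ n : ℤ, c n = ∫ t in (0:ℝ)..1, f t * e (-(n : ℝ) * t)) :
    Summable (fun n : {n : ℤ // n ≠ 0} =>
      ((|n.1| : ℤ) : ℝ) ^ (α - 1/2) * ‖c n.1‖) := by
  obtain ⟨C, -, hf⟩ := hHolder
  obtain ⟨s, hαs, hsβ⟩ := exists_between hαβ
  have h₁ := summable_abs_rpow_mul_norm_sq hper (hα.trans hαs).le hsβ hf hc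
  have h₂ : Summable (fun n : {n : ℤ // n ≠ 0} => |(n.1 : ℝ)| ^ (-(1 + 2 * (s - α)))) :=
    (Real.summable_abs_int_rpow (by linarith)).comp_injective Subtype.val_injective
  refine Summable.of_nonneg_of_le (fun n => by positivity) (fun n => ?_) (h₂.add h₁)
  have hn : 0 < |(n.1 : ℝ)| := abs_pos.2 (Int.cast_ne_zero.2 n.2)
  have hsplit : |(n.1 : ℝ)| ^ (α - 1 / 2) =
      |(n.1 : ℝ)| ^ (-(1 / 2 + (s - α))) * |(n.1 : ℝ)| ^ s := by
    rw [← Real.rpow_add hn]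
    congr 1
    ring
  have hsq : |(n.1 : ℝ)| ^ (-(1 + 2 * (s - α))) = (|(n.1 : ℝ)| ^ (-(1 / 2 + (s - α)))) ^ 2 := by
    rw [← Real.rpow_natCast, ← Real.rpow_mul hn.le]
    congr 1
    push_cast
    ring
  rw [Int.cast_abs, hsplit, hsq, mul_assoc]
  have hx : 0 ≤ |(n.1 : ℝ)| ^ (-(1 / 2 + (s - α))) := by positivity
  have hy : 0 ≤ |(n.1 : ℝ)| ^ s * ‖c n.1‖ := by positivity
  nlinarith [two_mul_le_add_sq (|(n.1 : ℝ)| ^ (-(1 / 2 + (s - α)))) (|(n.1 : ℝ)| ^ s * ‖c n.1‖),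
    mul_nonneg hx hy]
end

section
/- Let g : ℝ → ℝ be defined by g(x) = ∑_{n=1}^∞ n^{−2} sin(2πn²x). For every irrational number x₀ and every real α > 3/4, limsup_{x → x₀} |x − x₀|^{−α} · |g(x) − g(x₀)| = ∞. In particular, g is not differentiable at any irrational point. -/
open Filter Topology

/-- Riemann's nondifferentiable function `g(x) = ∑_{n ≥ 1} n⁻² sin(2πn²x)`.
(The `n = 0` term of the `tsum` vanishes, since `sin 0 = 0`.) -/
noncomputable def g (x : ℝ) : ℝ :=
  ∑' n : ℕ, Real.sin (2 * Real.pi * (n : ℝ) ^ 2 * x) / (n : ℝ) ^ 2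

open MeasureTheory

theorem ZMod.norm_sq_sum_stdAddChar_quadratic {q : ℕ} [NeZero q] {a : ZMod q}
    (ha : IsUnit (2 * a)) (b : ZMod q) :
    ‖∑ r : ZMod q, ZMod.stdAddChar (a * r ^ 2 + b * r)‖ ^ 2 = q := by
  have key : ∀ t : ZMod q, ∑ s : ZMod q, ZMod.stdAddChar (a * (t + s) ^ 2 + b * (t + s)) *
      ZMod.stdAddChar (-(a * s ^ 2 + b * s)) =
      if t = 0 then (q : ℂ) else 0 := by
    intro t
    have h (s : ZMod q) : ZMod.stdAddChar (a * (t + s) ^ 2 + b * (t + s)) *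
        ZMod.stdAddChar (-(a * s ^ 2 + b * s)) =
        ZMod.stdAddChar (a * t ^ 2 + b * t) * ZMod.stdAddChar (s * (2 * a * t)) := by
      rw [← AddChar.map_add_eq_mul, ← AddChar.map_add_eq_mul]
      ring_nf
    simp_rw [h]
    rw [← Finset.mul_sum, AddChar.sum_mulShift _ (ZMod.isPrimitive_stdAddChar q)]
    simp only [ha.mul_right_eq_zero, ZMod.card]
    split_ifs with ht
    · simp [ht]
    · simp
  have main : ((‖∑ r : ZMod q, ZMod.stdAddChar (a * r ^ 2 + b * r)‖ ^ 2 : ℝ) : ℂ) = q := by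
    push_cast
    rw [← Complex.mul_conj', map_sum, Finset.sum_mul_sum, Finset.sum_comm]
    simp_rw [← AddChar.map_neg_eq_conj]
    have (s : ZMod q) : ∑ r : ZMod q, ZMod.stdAddChar (a * r ^ 2 + b * r) *
        ZMod.stdAddChar (-(a * s ^ 2 + b * s)) =
        ∑ t : ZMod q, ZMod.stdAddChar (a * (t + s) ^ 2 + b * (t + s)) *
        ZMod.stdAddChar (-(a * s ^ 2 + b * s)) :=
      (_root_.Equiv.sum_comp (Equiv.addRight s) fun r : ZMod q ↦
        ZMod.stdAddChar (a * r ^ 2 + b * r) *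
        ZMod.stdAddChar (-(a * s ^ 2 + b * s))).symm
    simp_rw [this]
    rw [Finset.sum_comm]
    simp_rw [key]
    simp
  exact_mod_cast main


theorem summable_exp_neg_mul_int_sq {c : ℝ} (hc : 0 < c) :
    Summable fun n : ℤ ↦ Real.exp (-Real.pi * (n : ℝ) ^ 2 * c) := by
  have h := (summable_jacobiTheta₂_term_iff 0 (c * Complex.I)).mpr (by simpa using hc)
  have := h.norm
  simp_rw [norm_jacobiTheta₂_term] at this
  refine this.congr fun n ↦ ?_
  simp

theorem tsum_exp_neg_int_sq_lt : ∑' n : ℤ, Real.exp (-Real.pi * (n : ℝ) ^ 2) < 3 / 2 := by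
  have hI : 0 < Complex.I.im := by simp
  have h := norm_jacobiTheta_sub_one_le hI
  have h2 : jacobiTheta Complex.I = ((∑' n : ℤ, Real.exp (-Real.pi * (n : ℝ) ^ 2) : ℝ) : ℂ) := by
    rw [jacobiTheta, Complex.ofReal_tsum]
    refine tsum_congr fun n ↦ ?_
    push_cast
    congr 1
    linear_combination (Real.pi * (n : ℂ) ^ 2) * Complex.I_mul_I
  rw [h2] at h
  have h3 : |(∑' n : ℤ, Real.exp (-Real.pi * (n : ℝ) ^ 2)) - 1| ≤
      2 / (1 - Real.exp (-Real.pi)) * Real.exp (-Real.pi) := by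
    simpa [← Complex.ofReal_one, ← Complex.ofReal_sub] using h
  have h4 : Real.exp (-Real.pi) ≤ 1 / 8 := by
    rw [Real.exp_neg, ← one_div]
    apply one_div_le_one_div_of_le (by norm_num)
    calc (8 : ℝ) = 2 ^ 3 := by norm_num
      _ ≤ Real.exp 1 ^ 3 := by gcongr; linarith [Real.exp_one_gt_d9]
      _ = Real.exp 3 := by rw [← Real.exp_nat_mul]; norm_num
      _ ≤ Real.exp Real.pi := Real.exp_le_exp.mpr Real.pi_gt_three.le
  have h5 : 2 / (1 - Real.exp (-Real.pi)) * Real.exp (-Real.pi) < 1 / 2 := by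
    rw [div_mul_eq_mul_div, div_lt_div_iff₀ (by linarith) (by norm_num)]
    linarith
  linarith [le_abs_self ((∑' n : ℤ, Real.exp (-Real.pi * (n : ℝ) ^ 2)) - 1)]

theorem ZMod.norm_stdAddChar {q : ℕ} [NeZero q] (x : ZMod q) : ‖ZMod.stdAddChar x‖ = 1 :=
  AddChar.norm_apply _ _

theorem norm_cexp_neg_pi_mul_int_sq (m : ℤ) :
    ‖Complex.exp (-Real.pi * (m : ℂ) ^ 2)‖ = Real.exp (-Real.pi * (m : ℝ) ^ 2) := by
  have : (-Real.pi * (m : ℂ) ^ 2 : ℂ) = ((-Real.pi * (m : ℝ) ^ 2 : ℝ) : ℂ) := by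
    push_cast; ring
  rw [this, Complex.norm_exp, Complex.ofReal_re]

theorem summable_stdAddChar_mul_exp (p : ℤ) (q : ℕ) [NeZero q] :
    Summable fun n : ℤ ↦ ZMod.stdAddChar ((p : ZMod q) * (n : ZMod q) ^ 2) *
        Complex.exp (-Real.pi * ((n : ℂ) / q) ^ 2) := by
  have hq : (0 : ℝ) < q := by exact_mod_cast NeZero.pos q
  refine Summable.of_norm_bounded
    (summable_exp_neg_mul_int_sq (c := 1 / (q : ℝ) ^ 2) (by positivity)) fun n ↦ ?_
  rw [norm_mul, ZMod.norm_stdAddChar, one_mul, Complex.norm_exp]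
  refine le_of_eq (congrArg _ ?_)
  have : (-Real.pi * ((n : ℂ) / q) ^ 2 : ℂ) =
    ((-Real.pi * (n : ℝ) ^ 2 * (1 / (q : ℝ) ^ 2) : ℝ) : ℂ) := by
    push_cast; ring
  rw [this, Complex.ofReal_re]

/-- Poisson summation over one residue class. -/
theorem tsum_stdAddChar_mul_exp_residue (p : ℤ) (q : ℕ) [NeZero q] (r : ℕ) :
    ∑' m : ℤ, ZMod.stdAddChar ((p : ZMod q) * ((m * q + r : ℤ) : ZMod q) ^ 2) *
        Complex.exp (-Real.pi * (((m * q + r : ℤ) : ℂ) / q) ^ 2) =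
      ∑' m : ℤ, ZMod.stdAddChar ((p : ZMod q) * (r : ZMod q) ^ 2 + (-m : ZMod q) * (r : ZMod q)) *
        Complex.exp (-Real.pi * (m : ℂ) ^ 2) := by
  have hq : (q : ℂ) ≠ 0 := by exact_mod_cast NeZero.ne q
  have h := Complex.tsum_exp_neg_quadratic (a := 1) (by simp) (-Complex.I * r / q)
  simp only [Complex.one_cpow, div_one, one_mul, mul_one] at h
  have hI : Complex.I * (-Complex.I * r / q) = r / q := by
    linear_combination (-(r : ℂ) / q) * Complex.I_mul_I
  have e1 (m : ℤ) : ZMod.stdAddChar ((p : ZMod q) * ((m * q + r : ℤ) : ZMod q) ^ 2) *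
        Complex.exp (-Real.pi * (((m * q + r : ℤ) : ℂ) / q) ^ 2) =
      ZMod.stdAddChar ((p : ZMod q) * (r : ZMod q) ^ 2) *
        Complex.exp (-Real.pi * (m + Complex.I * (-Complex.I * r / q)) ^ 2) := by
    have c1 : ((m * q + r : ℤ) : ZMod q) = r := by simp
    have c2 : ((m * q + r : ℤ) : ℂ) / q = m + r / q := by
      push_cast
      field_simp
    rw [c1, c2, hI]
  have e2 (m : ℤ) : ZMod.stdAddChar ((-m : ZMod q) * (r : ZMod q)) =
      Complex.exp (2 * Real.pi * (-Complex.I * r / q) * m) := by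
    have c : ((-m : ZMod q) * (r : ZMod q)) = ((-m * r : ℤ) : ZMod q) := by push_cast; ring
    rw [c, ZMod.stdAddChar_coe]
    congr 1
    push_cast
    ring
  rw [tsum_congr e1, tsum_mul_left, ← h, ← tsum_mul_left]
  refine tsum_congr fun m ↦ ?_
  rw [AddChar.map_add_eq_mul, e2, Complex.exp_add]
  ring

theorem ZMod.sum_fin_natCast {M : Type*} [AddCommMonoid M] {q : ℕ} [NeZero q] (F : ZMod q → M) :
    ∑ r : Fin q, F ((r : ℕ) : ZMod q) = ∑ r : ZMod q, F r := by
  have hbij : Function.Bijective fun r : Fin q ↦ ((r : ℕ) : ZMod q) := by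
    rw [Fintype.bijective_iff_injective_and_card]
    refine ⟨fun r s hrs ↦ ?_, by simp [ZMod.card]⟩
    have := congrArg ZMod.val hrs
    simp only [ZMod.val_natCast_of_lt r.2, ZMod.val_natCast_of_lt s.2] at this
    exact Fin.ext this
  exact hbij.sum_comp F

theorem tsum_int_eq_sum_fin {f : ℤ → ℂ} (hf : Summable f) (q : ℕ) [NeZero q] :
    ∑' n, f n = ∑ r : Fin q, ∑' m : ℤ, f (m * q + (r : ℕ)) := by
  have hsum : Summable fun x : ℤ × Fin q ↦ f (x.1 * q + (x.2 : ℕ)) :=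
    ((Int.divModEquiv q).symm.summable_iff).mpr hf
  calc ∑' n, f n = ∑' x : ℤ × Fin q, f (x.1 * q + (x.2 : ℕ)) :=
        ((Int.divModEquiv q).symm.tsum_eq f).symm
    _ = ∑' m : ℤ, ∑ r : Fin q, f (m * q + (r : ℕ)) := by
        rw [hsum.tsum_prod]
        simp_rw [tsum_fintype]
    _ = ∑ r : Fin q, ∑' m : ℤ, f (m * q + (r : ℕ)) :=
        Summable.tsum_finsetSum fun r _ ↦ hsum.prod_symm.prod_factor r

/-- Poisson summation for the theta series near the rational point `p / q`. -/
theorem tsum_stdAddChar_mul_exp_eq (p : ℤ) (q : ℕ) [NeZero q] :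
    ∑' n : ℤ, ZMod.stdAddChar ((p : ZMod q) * (n : ZMod q) ^ 2) *
        Complex.exp (-Real.pi * ((n : ℂ) / q) ^ 2) =
      ∑' m : ℤ, (∑ r : ZMod q, ZMod.stdAddChar ((p : ZMod q) * r ^ 2 + (-m : ZMod q) * r)) *
        Complex.exp (-Real.pi * (m : ℂ) ^ 2) := by
  rw [tsum_int_eq_sum_fin (summable_stdAddChar_mul_exp p q) q]
  simp_rw [tsum_stdAddChar_mul_exp_residue]
  rw [← Summable.tsum_finsetSum fun r _ ↦ ?_]
  · refine tsum_congr fun m ↦ ?_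
    rw [Finset.sum_mul]
    exact ZMod.sum_fin_natCast fun r : ZMod q ↦ ZMod.stdAddChar ((p : ZMod q) * r ^ 2 +
      (-m : ZMod q) * r) * Complex.exp (-Real.pi * (m : ℂ) ^ 2)
  · refine Summable.of_norm_bounded (summable_exp_neg_mul_int_sq one_pos) fun m ↦ ?_
    rw [norm_mul, ZMod.norm_stdAddChar, norm_cexp_neg_pi_mul_int_sq, one_mul, mul_one]

theorem sqrt_le_norm_tsum_stdAddChar_mul_exp {p : ℤ} {q : ℕ} [NeZero q] (hodd : Odd q)
    (hp : IsUnit (p : ZMod q)) :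
    √q / 2 ≤ ‖∑' n : ℤ, ZMod.stdAddChar ((p : ZMod q) * (n : ZMod q) ^ 2) *
        Complex.exp (-Real.pi * ((n : ℂ) / q) ^ 2)‖ := by
  rw [tsum_stdAddChar_mul_exp_eq]
  have h2 : IsUnit (2 * (p : ZMod q)) := by
    refine IsUnit.mul ?_ hp
    have := (ZMod.isUnit_iff_coprime 2 q).mpr (Nat.coprime_two_left.mpr hodd)
    exact_mod_cast this
  set G : ℤ → ℂ := fun m ↦
    ∑ r : ZMod q, ZMod.stdAddChar ((p : ZMod q) * r ^ 2 + (-m : ZMod q) * r) with hG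
  have hGn (m : ℤ) : ‖G m‖ = √q := by
    rw [← ZMod.norm_sq_sum_stdAddChar_quadratic h2 (-m : ZMod q), Real.sqrt_sq (norm_nonneg _)]
  have hw (m : ℤ) : ‖G m * Complex.exp (-Real.pi * (m : ℂ) ^ 2)‖ =
      √q * Real.exp (-Real.pi * (m : ℝ) ^ 2) := by
    rw [norm_mul, hGn, norm_cexp_neg_pi_mul_int_sq]
  have hs : Summable fun m : ℤ ↦ Real.exp (-Real.pi * (m : ℝ) ^ 2) := by
    simpa using summable_exp_neg_mul_int_sq one_pos
  have hs2 : Summable fun m : ℤ ↦ ‖G m * Complex.exp (-Real.pi * (m : ℂ) ^ 2)‖ := by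
    simp_rw [hw]
    exact hs.mul_left _
  have hlt := tsum_exp_neg_int_sq_lt
  rw [hs.tsum_eq_add_tsum_ite 0] at hlt
  rw [hs2.of_norm.tsum_eq_add_tsum_ite 0]
  have hrest : ‖∑' m : ℤ, if m = 0 then 0 else G m * Complex.exp (-Real.pi * (m : ℂ) ^ 2)‖ ≤
      √q * ∑' m : ℤ, if m = 0 then 0 else Real.exp (-Real.pi * (m : ℝ) ^ 2) := by
    rw [← tsum_mul_left]
    refine tsum_of_norm_bounded (Summable.hasSum ?_) fun m ↦ ?_
    · refine ((hs.mul_left √q).of_nonneg_of_le (fun m ↦ ?_) fun m ↦ ?_)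
      · split_ifs <;> positivity
      · split_ifs
        · simp; positivity
        · rfl
    · split_ifs
      · simp
      · exact (hw m).le
  have h0 := hw 0
  simp only [Int.cast_zero, ne_eq, OfNat.ofNat_ne_zero, not_false_eq_true, zero_pow, mul_zero,
    Real.exp_zero, mul_one] at h0 hlt
  have hq0 : 0 ≤ √(q : ℝ) := Real.sqrt_nonneg _
  refine le_trans ?_ (norm_sub_le_norm_add _ _)
  simp only [Int.cast_zero, ne_eq, OfNat.ofNat_ne_zero, not_false_eq_true, zero_pow, mul_zero]
  rw [h0]
  nlinarith

theorem exists_odd_approx {x : ℝ} (hx : Irrational x) (N : ℕ) :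
    ∃ (p : ℤ) (q : ℕ), N < q ∧ Odd q ∧ IsUnit (p : ZMod q) ∧ |x - p / q| ≤ 6 / (q : ℝ) ^ 2 := by
  obtain ⟨r, hr, hN⟩ : ∃ r : ℚ, |x - r| ≤ 1 / (r.den : ℝ) ^ 2 ∧ N < r.den := by
    have h1 := hx.eventually_forall_le_dist_cast_rat_of_den_le N
    obtain ⟨n, hn0, hn⟩ := (((tendsto_one_div_add_atTop_nhds_zero_nat (𝕜 := ℝ)).eventually
      h1).and (eventually_gt_atTop 0)).exists.imp fun n h ↦ And.intro h.2 h.1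
    obtain ⟨r, hr, hrn⟩ := Real.exists_rat_abs_sub_le_and_den_le x (n := n + 1) (by omega)
    have hd : (0 : ℝ) < r.den := by exact_mod_cast r.den_pos
    have hd1 : (1 : ℝ) ≤ r.den := by exact_mod_cast r.den_pos
    have hdn : (r.den : ℝ) ≤ n + 1 := by exact_mod_cast hrn
    refine ⟨r, hr.trans ?_, ?_⟩
    · rw [sq]
      push_cast
      gcongr
      linarith
    · by_contra! hle
      have h2 := hn r hle
      rw [Real.dist_eq] at h2
      have h3 := h2.trans hr
      rw [div_le_div_iff₀ (by positivity) (by positivity)] at h3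
      push_cast at h3
      nlinarith
  have hd : (0 : ℝ) < r.den := by exact_mod_cast r.den_pos
  have hrat : (r : ℝ) = r.num / r.den := by exact_mod_cast (Rat.num_div_den r).symm
  have hcop : IsCoprime r.num (r.den : ℤ) := by
    rw [Int.isCoprime_iff_gcd_eq_one]; simpa [Int.gcd] using r.reduced
  have unit_of {p : ℤ} {q : ℕ} (h : IsCoprime p (q : ℤ)) : IsUnit (p : ZMod q) := by
    obtain ⟨u, v, huv⟩ := h
    refine IsUnit.of_mul_eq_one (u : ZMod q) ?_
    have := congrArg (Int.cast : ℤ → ZMod q) huv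
    push_cast at this
    simpa [mul_comm] using this
  rcases Nat.even_or_odd r.den with he | ho
  · obtain ⟨u, v, huv⟩ := hcop
    set d : ℤ := (r.den : ℤ) with hdd
    have hdpos : 0 < d := Int.natCast_pos.mpr r.den_pos
    set s : ℤ := u % d + d with hs
    have hs1 : d ≤ s := by have := Int.emod_nonneg u hdpos.ne'; omega
    have hs2 : s ≤ 2 * d := by have := Int.emod_lt_of_pos u hdpos; omega
    obtain ⟨k, hk⟩ : ∃ k : ℤ, k * d = s * r.num - 1 := by
      refine ⟨-v + r.num - (u / d) * r.num, ?_⟩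
      have := Int.emod_add_mul_ediv u d
      rw [hs]
      linear_combination -huv - r.num * this
    obtain ⟨S, hS⟩ : ∃ S : ℕ, s = S := ⟨s.toNat, by omega⟩
    have hSd : (r.den : ℝ) ≤ S := by
      have : (r.den : ℤ) ≤ S := by omega
      exact_mod_cast this
    have hS2 : (S : ℝ) ≤ 2 * r.den := by
      have : (S : ℤ) ≤ 2 * r.den := by omega
      exact_mod_cast this
    have hS0 : (0 : ℝ) < S := hd.trans_le hSd
    refine ⟨k, S, by omega, ?_, unit_of ⟨-d, r.num, by rw [← hS]; linear_combination -hk⟩, ?_⟩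
    · rw [← Int.odd_coe_nat, ← hS]
      by_contra hne
      rw [Int.not_odd_iff_even] at hne
      have he' : Even d := by rw [hdd]; exact_mod_cast he
      have h1 : Even (s * r.num - k * d) := (hne.mul_right _).sub (he'.mul_left _)
      rw [hk] at h1
      simp at h1
    · have hkR : (k : ℝ) * r.den = S * r.num - 1 := by
        rw [hS] at hk
        exact_mod_cast hk
      have h1 : (r : ℝ) - k / S = 1 / (r.den * S) := by
        rw [hrat]
        field_simp
        linarith
      calc |x - k / S| = |(x - r) + (r - k / S)| := by ring_nf
        _ ≤ 1 / (r.den : ℝ) ^ 2 + 1 / (r.den * S) := by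
          refine (abs_add_le _ _).trans (add_le_add hr ?_)
          rw [h1, abs_of_pos (by positivity)]
        _ ≤ 1 / ((S : ℝ) / 2) ^ 2 + 1 / ((S : ℝ) / 2 * S) := by
          gcongr <;> linarith
        _ = 6 / (S : ℝ) ^ 2 := by field_simp; norm_num
  · refine ⟨r.num, r.den, hN, ho, unit_of hcop, ?_⟩
    rw [← hrat]
    refine hr.trans ?_
    gcongr
    norm_num

theorem integral_Ioi_id_mul_cexp_neg {r : ℂ} (hr : 0 < r.re) :
    ∫ t : ℝ in Set.Ioi 0, (t : ℂ) * Complex.exp (-r * t) = 1 / r ^ 2 := by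
  have hr0 : r ≠ 0 := by rintro rfl; simp at hr
  have hnorm (t : ℝ) : ‖Complex.exp (-r * t)‖ = Real.exp (-r.re * t) := by
    rw [Complex.norm_exp]; simp
  have hderiv : ∀ x ∈ Set.Ici (0 : ℝ), HasDerivAt
      (fun t : ℝ ↦ -((t : ℂ) / r + 1 / r ^ 2) * Complex.exp (-r * t))
      ((x : ℂ) * Complex.exp (-r * x)) x := by
    intro x _
    have hid : HasDerivAt (fun t : ℝ ↦ (t : ℂ)) 1 x := Complex.ofRealCLM.hasDerivAt
    have h1 := (((hid.div_const r).add_const (1 / r ^ 2)).neg).mul ((hid.const_mul (-r)).cexp)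
    convert! h1 using 1
    simp only [Pi.neg_apply]
    field_simp
    ring
  have hintegrable : IntegrableOn (fun t : ℝ ↦ (t : ℂ) * Complex.exp (-r * t)) (Set.Ioi 0) := by
    have := integrableOn_rpow_mul_exp_neg_mul_rpow (s := 1) (p := 1) (b := r.re)
      (by norm_num) (by norm_num) hr
    refine this.mono' (by fun_prop) ?_
    filter_upwards [ae_restrict_mem measurableSet_Ioi] with t ht
    rw [norm_mul, hnorm, Complex.norm_real, Real.norm_of_nonneg (le_of_lt ht)]
    simp
  have htend : Tendsto (fun t : ℝ ↦ -((t : ℂ) / r + 1 / r ^ 2) * Complex.exp (-r * t))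
      atTop (𝓝 0) := by
    have e0 : Tendsto (fun t : ℝ ↦ Complex.exp (-r * t)) atTop (𝓝 0) := by
      rw [tendsto_zero_iff_norm_tendsto_zero]
      simp_rw [hnorm]
      simpa using tendsto_rpow_mul_exp_neg_mul_atTop_nhds_zero 0 r.re hr
    have e1 : Tendsto (fun t : ℝ ↦ (t : ℂ) * Complex.exp (-r * t)) atTop (𝓝 0) := by
      rw [tendsto_zero_iff_norm_tendsto_zero]
      simp_rw [norm_mul, hnorm, Complex.norm_real]
      refine (tendsto_rpow_mul_exp_neg_mul_atTop_nhds_zero 1 r.re hr).congr' ?_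
      filter_upwards [eventually_ge_atTop 0] with t ht
      rw [Real.rpow_one, Real.norm_of_nonneg ht]
    have := (e1.const_mul (-1 / r)).sub (e0.const_mul (1 / r ^ 2))
    simp only [mul_zero, sub_zero] at this
    refine this.congr fun t ↦ ?_
    ring
  rw [integral_Ioi_of_hasDerivAt_of_tendsto' hderiv hintegrable htend]
  simp

theorem norm_add_two_pi_I_mul_sq (Y u : ℝ) :
    ‖((Y : ℂ) + 2 * Real.pi * Complex.I * u) ^ 2‖ = Y ^ 2 + (2 * Real.pi * u) ^ 2 := by
  rw [norm_pow, ← Complex.normSq_eq_norm_sq, Complex.normSq_apply]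
  simp
  ring

theorem integrable_one_div_sq {Y : ℝ} (hY : 0 < Y) :
    Integrable fun u : ℝ ↦ 1 / ((Y : ℂ) + 2 * Real.pi * Complex.I * u) ^ 2 := by
  have h := (integrable_inv_one_add_sq.comp_mul_left' (R := 2 * Real.pi / Y)
    (by positivity)).const_mul (Y⁻¹ ^ 2)
  refine h.mono' ?_ (Eventually.of_forall fun u ↦ ?_)
  · exact Measurable.aestronglyMeasurable (by fun_prop)
  · rw [norm_div, norm_add_two_pi_I_mul_sq, norm_one]
    refine le_of_eq ?_
    field_simp

theorem integral_cexp_div_sq {Y : ℝ} (hY : 0 < Y) (t : ℝ) :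
    ∫ u : ℝ, Complex.exp (2 * Real.pi * Complex.I * t * u) / (Y + 2 * Real.pi * Complex.I * u) ^ 2 =
      ((max t 0 * Real.exp (-Y * t) : ℝ) : ℂ) := by
  set f : ℝ → ℂ := fun t ↦ ((max t 0 * Real.exp (-Y * t) : ℝ) : ℂ) with hf
  have hfc : Continuous f := by fun_prop
  have hind : ∀ (φ : ℝ → ℂ), (fun t ↦ φ t * f t) =
      Set.indicator (Set.Ioi 0) fun t : ℝ ↦ φ t * (t * Complex.exp (-Y * t)) := by
    intro φ
    ext t
    rcases le_or_gt t 0 with ht | ht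
    · rw [Set.indicator_of_notMem (by simpa using ht)]
      simp [f, max_eq_right ht]
    · rw [Set.indicator_of_mem (by simpa using ht)]
      simp [f, max_eq_left ht.le]
  have hfi : Integrable f := by
    have h1 := hind fun _ ↦ 1
    simp only [one_mul] at h1
    change Integrable fun t ↦ f t
    rw [h1, integrable_indicator_iff measurableSet_Ioi]
    have := integrableOn_rpow_mul_exp_neg_mul_rpow (s := 1) (p := 1) (b := Y)
      (by norm_num) (by norm_num) hY
    refine this.ofReal.congr ?_
    filter_upwards [ae_restrict_mem measurableSet_Ioi] with t ht
    simp
  have hF : ∀ u : ℝ, FourierTransform.fourier f u = 1 / (Y + 2 * Real.pi * Complex.I * u) ^ 2 := by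
    intro u
    rw [Real.fourier_real_eq_integral_exp_smul]
    simp only [smul_eq_mul]
    rw [hind, integral_indicator measurableSet_Ioi,
      ← integral_Ioi_id_mul_cexp_neg (r := Y + 2 * Real.pi * Complex.I * u) (by simpa using hY)]
    refine integral_congr_ae (Eventually.of_forall fun t ↦ ?_)
    simp only
    rw [mul_left_comm, ← Complex.exp_add]
    congr 2
    push_cast
    ring
  have hinv := hfi.fourierInv_fourier_eq (by
    rw [funext hF]; exact integrable_one_div_sq hY) (v := t) hfc.continuousAt
  rw [Real.fourierInv_eq'] at hinv
  refine Eq.trans ?_ hinv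
  refine integral_congr_ae (Eventually.of_forall fun u ↦ ?_)
  simp only [hF, smul_eq_mul, RCLike.inner_apply, conj_trivial]
  rw [mul_one_div]
  congr 2
  push_cast
  ring

theorem norm_sin_div_sq_le (n : ℕ) (x : ℝ) :
    ‖Real.sin (2 * Real.pi * (n : ℝ) ^ 2 * x) / (n : ℝ) ^ 2‖ ≤ 1 / (n : ℝ) ^ 2 := by
  rw [norm_div, Real.norm_of_nonneg (sq_nonneg (n : ℝ))]
  gcongr
  exact Real.abs_sin_le_one _

theorem continuous_g : Continuous g :=
  continuous_tsum (fun n ↦ by fun_prop) (Real.summable_one_div_nat_pow.mpr one_lt_two)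
    norm_sin_div_sq_le

theorem exists_abs_g_le : ∃ B : ℝ, ∀ x, |g x| ≤ B :=
  ⟨_, fun x ↦ tsum_of_norm_bounded
    (Real.summable_one_div_nat_pow.mpr one_lt_two).hasSum fun n ↦ norm_sin_div_sq_le n x⟩

theorem integrable_cexp_mul_one_div_sq {Y : ℝ} (hY : 0 < Y) (t : ℝ) :
    Integrable fun u : ℝ ↦ Complex.exp (2 * Real.pi * Complex.I * t * u) /
      ((Y : ℂ) + 2 * Real.pi * Complex.I * u) ^ 2 := by
  refine (integrable_one_div_sq hY).mono (Measurable.aestronglyMeasurable (by fun_prop))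
    (Eventually.of_forall fun u ↦ le_of_eq ?_)
  have : (2 * Real.pi * Complex.I * t * u : ℂ) = (2 * Real.pi * t * u : ℝ) * Complex.I := by
    push_cast; ring
  rw [norm_div, norm_div, this, Complex.norm_exp_ofReal_mul_I, norm_one]

theorem integral_sin_div_sq {Y : ℝ} (hY : 0 < Y) (a t : ℝ) (ht : 0 ≤ t) :
    ∫ u : ℝ, (Real.sin (2 * Real.pi * t * (a + u)) : ℂ) *
        (1 / ((Y : ℂ) + 2 * Real.pi * Complex.I * u) ^ 2) =
      Complex.exp (2 * Real.pi * Complex.I * t * a) * (t * Real.exp (-Y * t)) /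
        (2 * Complex.I) := by
  have h1 := integral_cexp_div_sq hY t
  have h2 := integral_cexp_div_sq hY (-t)
  rw [max_eq_left ht] at h1
  rw [max_eq_right (by linarith)] at h2
  have e (u : ℝ) : (Real.sin (2 * Real.pi * t * (a + u)) : ℂ) *
        (1 / ((Y : ℂ) + 2 * Real.pi * Complex.I * u) ^ 2) =
      (Complex.exp (2 * Real.pi * Complex.I * t * a) / (2 * Complex.I)) *
        (Complex.exp (2 * Real.pi * Complex.I * t * u) /
          ((Y : ℂ) + 2 * Real.pi * Complex.I * u) ^ 2) -
      (Complex.exp (-(2 * Real.pi * Complex.I * t * a)) / (2 * Complex.I)) *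
        (Complex.exp (2 * Real.pi * Complex.I * (-t : ℝ) * u) /
          ((Y : ℂ) + 2 * Real.pi * Complex.I * u) ^ 2) := by
    have hs : (Real.sin (2 * Real.pi * t * (a + u)) : ℂ) =
        (Complex.exp (2 * Real.pi * Complex.I * t * a) *
            Complex.exp (2 * Real.pi * Complex.I * t * u) -
          Complex.exp (-(2 * Real.pi * Complex.I * t * a)) *
            Complex.exp (2 * Real.pi * Complex.I * (-t : ℝ) * u)) / (2 * Complex.I) := by
      rw [← Complex.exp_add, ← Complex.exp_add, Complex.ofReal_sin, Complex.sin,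
        eq_div_iff (by simp)]
      have e1 : (2 * Real.pi * Complex.I * t * a + 2 * Real.pi * Complex.I * t * u : ℂ) =
        ((2 * Real.pi * t * (a + u) : ℝ) : ℂ) * Complex.I := by push_cast; ring
      have e2 : (-(2 * Real.pi * Complex.I * t * a) +
          2 * Real.pi * Complex.I * (-t : ℝ) * u : ℂ) =
        -((2 * Real.pi * t * (a + u) : ℝ) : ℂ) * Complex.I := by push_cast; ring
      rw [e1, e2]
      linear_combination (Complex.exp (-((2 * Real.pi * t * (a + u) : ℝ) : ℂ) * Complex.I) -
        Complex.exp (((2 * Real.pi * t * (a + u) : ℝ) : ℂ) * Complex.I)) * Complex.I_mul_I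
    rw [hs]
    ring
  simp_rw [e]
  rw [integral_sub ((integrable_cexp_mul_one_div_sq hY t).const_mul _)
    ((integrable_cexp_mul_one_div_sq hY (-t)).const_mul _), integral_const_mul,
    integral_const_mul, h1, h2]
  push_cast
  ring

theorem hasSum_integral_g_mul {Y : ℝ} (hY : 0 < Y) (a : ℝ) :
    HasSum (fun n : ℕ ↦ if n = 0 then 0 else
      Complex.exp (2 * Real.pi * Complex.I * (n : ℂ) ^ 2 * a) * Complex.exp (-Y * (n : ℂ) ^ 2) /
        (2 * Complex.I))
      (∫ u : ℝ, (g (a + u) : ℂ) * (1 / ((Y : ℂ) + 2 * Real.pi * Complex.I * u) ^ 2)) := by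
  set K : ℝ → ℂ := fun u ↦ 1 / ((Y : ℂ) + 2 * Real.pi * Complex.I * u) ^ 2 with hK
  have hKi : Integrable K := integrable_one_div_sq hY
  set F : ℕ → ℝ → ℂ := fun n u ↦
    ((Real.sin (2 * Real.pi * (n : ℝ) ^ 2 * (a + u)) / (n : ℝ) ^ 2 : ℝ) : ℂ) * K u with hF
  have hFn (n : ℕ) (u : ℝ) : ‖F n u‖ ≤ 1 / (n : ℝ) ^ 2 * ‖K u‖ := by
    rw [hF, norm_mul, Complex.norm_real]
    gcongr
    exact norm_sin_div_sq_le n _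
  have hFi (n : ℕ) : Integrable (F n) :=
    (hKi.norm.const_mul (1 / (n : ℝ) ^ 2)).mono'
      (Measurable.aestronglyMeasurable (by fun_prop)) (Eventually.of_forall (hFn n))
  have hs : Summable fun n ↦ ∫ u, ‖F n u‖ := by
    refine Summable.of_nonneg_of_le (fun n ↦ integral_nonneg fun u ↦ norm_nonneg _) (fun n ↦ ?_)
      ((Real.summable_one_div_nat_pow.mpr one_lt_two).mul_right (∫ u, ‖K u‖))
    rw [← integral_const_mul]
    exact integral_mono (hFi n).norm (hKi.norm.const_mul _) (hFn n)
  convert! hasSum_integral_of_summable_integral_norm hFi hs using 1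
  · ext n
    split_ifs with hn
    · simp [hF, hn]
    · have hn' : (n : ℂ) ≠ 0 := by exact_mod_cast hn
      have h := integral_sin_div_sq hY a ((n : ℝ) ^ 2) (by positivity)
      have e (u : ℝ) : F n u = 1 / (n : ℂ) ^ 2 *
          ((Real.sin (2 * Real.pi * (n : ℝ) ^ 2 * (a + u)) : ℂ) * K u) := by
        simp only [hF]
        push_cast
        ring
      simp_rw [e]
      rw [integral_const_mul, h]
      push_cast
      field_simp
  · congr 1
    ext u
    simp only [hF]
    rw [tsum_mul_right, ← Complex.ofReal_tsum]
    rfl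

theorem integrable_rpow_div_one_add_sq {α : ℝ} (hα0 : 0 ≤ α) (hα1 : α < 1) :
    Integrable fun v : ℝ ↦ (2 + |v|) ^ α / (1 + (2 * Real.pi * v) ^ 2) := by
  have h := (integrable_one_add_norm (E := ℝ) (μ := volume) (r := 2 - α)
    (by simp; linarith)).const_mul (2 ^ α * 2)
  refine h.mono' (Measurable.aestronglyMeasurable (by fun_prop))
    (Eventually.of_forall fun v ↦ ?_)
  have hpos : 0 < 1 + |v| := by positivity
  rw [Real.norm_of_nonneg (by positivity), Real.norm_eq_abs, neg_sub, Real.rpow_sub hpos,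
    Real.rpow_two, div_le_iff₀ (by positivity)]
  have h1 : (2 + |v|) ^ α ≤ 2 ^ α * (1 + |v|) ^ α := by
    rw [← Real.mul_rpow (by norm_num) hpos.le]
    gcongr
    linarith [abs_nonneg v]
  refine h1.trans ?_
  have h2 : (1 + |v|) ^ 2 ≤ 2 * (1 + (2 * Real.pi * v) ^ 2) := by
    have : v ^ 2 ≤ (2 * Real.pi * v) ^ 2 := by
      rw [mul_pow]
      have : 1 ≤ (2 * Real.pi) ^ 2 := by nlinarith [Real.pi_gt_three]
      nlinarith [sq_nonneg v]
    nlinarith [sq_abs v, sq_nonneg (1 - |v|)]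
  calc 2 ^ α * (1 + |v|) ^ α = 2 ^ α * (1 + |v|) ^ α / (1 + |v|) ^ 2 * (1 + |v|) ^ 2 := by
        field_simp
    _ ≤ 2 ^ α * (1 + |v|) ^ α / (1 + |v|) ^ 2 * (2 * (1 + (2 * Real.pi * v) ^ 2)) := by gcongr
    _ = _ := by ring

theorem norm_integral_g_mul_le {α C x₀ : ℝ} (hα0 : 0 ≤ α) (hα1 : α < 1) (hC : 0 ≤ C)
    (hg : ∀ x, |g x - g x₀| ≤ C * |x - x₀| ^ α) {Y a : ℝ} (hY : 0 < Y) (ha : |a - x₀| ≤ 2 * Y) :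
    ‖∫ u : ℝ, (g (a + u) : ℂ) * (1 / ((Y : ℂ) + 2 * Real.pi * Complex.I * u) ^ 2)‖ ≤
      C * (∫ v : ℝ, (2 + |v|) ^ α / (1 + (2 * Real.pi * v) ^ 2)) * Y ^ (α - 1) := by
  set K : ℝ → ℂ := fun u ↦ 1 / ((Y : ℂ) + 2 * Real.pi * Complex.I * u) ^ 2 with hK
  have hKi : Integrable K := integrable_one_div_sq hY
  set Φ : ℝ → ℝ := fun v ↦ (2 + |v|) ^ α / (1 + (2 * Real.pi * v) ^ 2) with hΦ
  have hΦi : Integrable Φ := integrable_rpow_div_one_add_sq hα0 hα1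
  have hK0 : ∫ u, K u = 0 := by simpa [hK] using integral_cexp_div_sq hY 0
  obtain ⟨B, hB⟩ := exists_abs_g_le
  have hgK : Integrable fun u ↦ (g (a + u) : ℂ) * K u := by
    refine hKi.bdd_mul (c := B) ?_ (Eventually.of_forall fun u ↦ ?_)
    · exact (Complex.continuous_ofReal.comp
        (continuous_g.comp (continuous_const.add continuous_id))).aestronglyMeasurable
    · rw [Complex.norm_real]; exact hB _
  have hsub : ∫ u, (g (a + u) : ℂ) * K u = ∫ u, ((g (a + u) - g x₀ : ℝ) : ℂ) * K u := by
    simp_rw [Complex.ofReal_sub, sub_mul]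
    rw [integral_sub hgK (hKi.const_mul _), integral_const_mul, hK0, mul_zero, sub_zero]
  have hpt (u : ℝ) : ‖((g (a + u) - g x₀ : ℝ) : ℂ) * K u‖ ≤ C * Y ^ (α - 2) * Φ (Y⁻¹ * u) := by
    rw [norm_mul, Complex.norm_real, Real.norm_eq_abs, hK, norm_div, norm_add_two_pi_I_mul_sq, norm_one]
    have h1 : |a + u - x₀| ≤ Y * (2 + |Y⁻¹ * u|) := by
      rw [abs_mul, abs_of_pos (inv_pos.mpr hY), mul_add, mul_inv_cancel_left₀ hY.ne']
      calc |a + u - x₀| = |(a - x₀) + u| := by ring_nf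
        _ ≤ _ := (abs_add_le _ _).trans (by linarith)
    have h2 : |g (a + u) - g x₀| ≤ C * (Y ^ α * (2 + |Y⁻¹ * u|) ^ α) := by
      refine (hg _).trans ?_
      rw [← Real.mul_rpow hY.le (by positivity)]
      gcongr
    have h3 : Y ^ (2 : ℕ) + (2 * Real.pi * u) ^ 2 =
        Y ^ 2 * (1 + (2 * Real.pi * (Y⁻¹ * u)) ^ 2) := by
      field_simp
    calc |g (a + u) - g x₀| * (1 / (Y ^ 2 + (2 * Real.pi * u) ^ 2))
        ≤ C * (Y ^ α * (2 + |Y⁻¹ * u|) ^ α) * (1 / (Y ^ 2 + (2 * Real.pi * u) ^ 2)) := by gcongr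
      _ = C * Y ^ (α - 2) * Φ (Y⁻¹ * u) := by
        rw [h3, Real.rpow_sub hY, Real.rpow_two]
        simp only [hΦ]
        field_simp
  rw [hsub]
  refine (norm_integral_le_of_norm_le ((hΦi.comp_mul_left' (inv_ne_zero hY.ne')).const_mul _)
    (Eventually.of_forall hpt)).trans (le_of_eq ?_)
  rw [integral_const_mul, Measure.integral_comp_mul_left, inv_inv, abs_of_pos hY, smul_eq_mul,
    show α - 1 = α - 2 + 1 by ring, Real.rpow_add_one hY.ne']
  ring

/-- The theta series at height `1 / (2q²)` above `p / q` is an integral of `g` against a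
squared Cauchy kernel. -/
theorem tsum_stdAddChar_mul_exp_eq_integral (p : ℤ) (q : ℕ) [NeZero q] :
    ∑' n : ℤ, ZMod.stdAddChar ((p : ZMod q) * (n : ZMod q) ^ 2) *
        Complex.exp (-Real.pi * ((n : ℂ) / q) ^ 2) =
      1 + 4 * Complex.I * ∫ u : ℝ, (g (p / q + u) : ℂ) *
        (1 / (((Real.pi / q ^ 2 : ℝ) : ℂ) + 2 * Real.pi * Complex.I * u) ^ 2) := by
  have hq : (0 : ℝ) < q := by exact_mod_cast NeZero.pos q
  have hqc : (q : ℂ) ≠ 0 := by exact_mod_cast NeZero.ne q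
  set J := ∫ u : ℝ, (g (p / q + u) : ℂ) *
        (1 / (((Real.pi / q ^ 2 : ℝ) : ℂ) + 2 * Real.pi * Complex.I * u) ^ 2) with hJ
  have h := (hasSum_integral_g_mul (Y := Real.pi / q ^ 2) (by positivity) (p / q)).mul_left
    (2 * Complex.I)
  rw [← hJ] at h
  set f : ℤ → ℂ := fun n ↦ ZMod.stdAddChar ((p : ZMod q) * (n : ZMod q) ^ 2) *
        Complex.exp (-Real.pi * ((n : ℂ) / q) ^ 2) with hf
  have h1 : HasSum (fun n : ℕ ↦ f n) (1 + 2 * Complex.I * J) := by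
    refine ((hasSum_ite_eq (0 : ℕ) (1 : ℂ)).add h).congr_fun fun n ↦ ?_
    by_cases hn : n = 0
    · simp [hn, hf]
    · simp only [hn, if_false, zero_add, hf]
      have e1 : ((p : ZMod q) * (((n : ℤ) : ZMod q)) ^ 2) = ((p * (n : ℤ) ^ 2 : ℤ) : ZMod q) := by
        push_cast; ring
      have e2 (A B : ℂ) : 2 * Complex.I * (A * B / (2 * Complex.I)) = A * B :=
        mul_div_cancel₀ _ (by simp)
      rw [e1, ZMod.stdAddChar_coe, e2]
      congr 2
      · push_cast
        field_simp
      · push_cast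
        field_simp
  have h2 : HasSum (fun n : ℕ ↦ f (-n)) (1 + 2 * Complex.I * J) := by
    refine h1.congr_fun fun n ↦ ?_
    simp only [hf]
    push_cast
    congr 2
    · ring
    · ring
  have h3 := h1.of_nat_of_neg h2
  have h0 : f 0 = 1 := by simp [hf]
  rw [h3.tsum_eq, h0]
  ring

theorem not_eventually_abs_g_sub_le_of_lt_one {x₀ : ℝ} (hx₀ : Irrational x₀) {α : ℝ} (hα : 3 / 4 < α)
    (hα1 : α < 1) (C : ℝ) : ¬ ∀ᶠ x in 𝓝[≠] x₀, |g x - g x₀| ≤ C * |x - x₀| ^ α := by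
  intro hev
  obtain ⟨B, hB⟩ := exists_abs_g_le
  have hα0 : 0 < α := by linarith
  obtain ⟨C', hC', hg⟩ : ∃ C' : ℝ, 0 ≤ C' ∧ ∀ x, |g x - g x₀| ≤ C' * |x - x₀| ^ α := by
    rw [eventually_nhdsWithin_iff, Metric.eventually_nhds_iff] at hev
    obtain ⟨δ, hδ, hev⟩ := hev
    refine ⟨max (|C|) (2 * B / δ ^ α), (abs_nonneg _).trans (le_max_left _ _), fun x ↦ ?_⟩
    have hB0 : 0 ≤ B := (abs_nonneg _).trans (hB 0)
    rcases eq_or_ne x x₀ with rfl | hne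
    · simp [Real.zero_rpow hα0.ne']
    rcases lt_or_ge |x - x₀| δ with hlt | hge
    · refine (hev (by rwa [Real.dist_eq]) hne).trans ?_
      gcongr
      exact (le_abs_self C).trans (le_max_left _ _)
    · calc |g x - g x₀| ≤ |g x| + |g x₀| := abs_sub _ _
        _ ≤ 2 * B / δ ^ α * δ ^ α := by
          rw [div_mul_cancel₀ _ (by positivity)]; linarith [hB x, hB x₀]
        _ ≤ _ := by
          gcongr
          exact le_max_right _ _
  set D : ℝ := ∫ v : ℝ, (2 + |v|) ^ α / (1 + (2 * Real.pi * v) ^ 2) with hD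
  set E : ℝ := 4 * (C' * D * Real.pi ^ (α - 1)) with hE
  have hbound : ∀ (p : ℤ) (q : ℕ), 0 < q → Odd q → IsUnit (p : ZMod q) →
      |x₀ - p / q| ≤ 6 / (q : ℝ) ^ 2 → √q / 2 ≤ 1 + E * (q : ℝ) ^ (2 - 2 * α) := by
    intro p q hq hodd hp hpq
    have : NeZero q := ⟨hq.ne'⟩
    have hqR : (0 : ℝ) < q := by exact_mod_cast hq
    have h1 := sqrt_le_norm_tsum_stdAddChar_mul_exp hodd hp
    rw [tsum_stdAddChar_mul_exp_eq_integral] at h1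
    have h2 := norm_integral_g_mul_le hα0.le hα1 hC' hg (Y := Real.pi / q ^ 2) (a := p / q)
      (by positivity) (by
        rw [abs_sub_comm]
        refine hpq.trans ?_
        rw [mul_div_assoc']
        gcongr
        linarith [Real.pi_gt_three])
    refine h1.trans ((norm_add_le _ _).trans ?_)
    rw [norm_one, norm_mul, norm_mul, Complex.norm_I, mul_one, Complex.norm_ofNat]
    have h3 : (Real.pi / (q : ℝ) ^ 2) ^ (α - 1) = Real.pi ^ (α - 1) * (q : ℝ) ^ (2 - 2 * α) := by
      rw [Real.div_rpow Real.pi_pos.le (by positivity), div_eq_mul_inv,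
        ← Real.rpow_neg (by positivity), ← Real.rpow_natCast, ← Real.rpow_mul hqR.le]
      congr 2
      push_cast
      ring
    rw [h3, ← hD] at h2
    rw [hE]
    linarith
  have hlim : Tendsto (fun q : ℕ ↦ (1 + E * (q : ℝ) ^ (2 - 2 * α)) / (q : ℝ) ^ (1 / 2 : ℝ))
      atTop (𝓝 0) := by
    have t1 := (tendsto_rpow_neg_atTop (y := 1 / 2) (by norm_num)).comp
      (tendsto_natCast_atTop_atTop (R := ℝ))
    have t2 := (tendsto_rpow_neg_atTop (y := 2 * α - 3 / 2) (by linarith)).comp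
      (tendsto_natCast_atTop_atTop (R := ℝ))
    have t := t1.add (t2.const_mul E)
    simp only [mul_zero, add_zero] at t
    refine t.congr' ?_
    filter_upwards [eventually_gt_atTop 0] with q hq
    have hqR : (0 : ℝ) < q := by exact_mod_cast hq
    simp only [Function.comp]
    rw [add_div, mul_div_assoc, ← Real.rpow_sub hqR, Real.rpow_neg hqR.le, one_div]
    ring_nf
  obtain ⟨N, hN⟩ := eventually_atTop.mp (hlim.eventually_lt_const (u := 1 / 2) (by norm_num))
  obtain ⟨p, q, hNq, hodd, hp, hpq⟩ := exists_odd_approx hx₀ N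
  have hq : 0 < q := by omega
  have hqR : (0 : ℝ) < q := by exact_mod_cast hq
  have h1 := hbound p q hq hodd hp hpq
  have h2 := hN q hNq.le
  rw [← Real.sqrt_eq_rpow, div_lt_iff₀ (by positivity)] at h2
  linarith

theorem not_eventually_abs_g_sub_le {x₀ : ℝ} (hx₀ : Irrational x₀) {α : ℝ} (hα : 3 / 4 < α)
    (C : ℝ) : ¬ ∀ᶠ x in 𝓝[≠] x₀, |g x - g x₀| ≤ C * |x - x₀| ^ α := by
  intro hev
  have h1 : ∀ᶠ x in 𝓝[≠] x₀, |x - x₀| < 1 := by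
    refine eventually_nhdsWithin_of_eventually_nhds ?_
    exact Metric.ball_mem_nhds x₀ one_pos
  refine not_eventually_abs_g_sub_le_of_lt_one hx₀ (α := min α (7 / 8)) (lt_min hα (by norm_num))
    ((min_le_right _ _).trans_lt (by norm_num)) |C| ?_
  filter_upwards [hev, h1, self_mem_nhdsWithin] with x hx hx1 hne
  have hpos : 0 < |x - x₀| := abs_pos.mpr (sub_ne_zero.mpr hne)
  refine hx.trans (mul_le_mul (le_abs_self C) ?_ (by positivity) (abs_nonneg C))
  exact Real.rpow_le_rpow_of_exponent_ge hpos hx1.le (min_le_left _ _)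

/-- At every irrational point, Riemann's function violates the pointwise Hölder
condition of any index `α > 3/4`; in particular it is not differentiable there. -/
theorem stmt_11 (x₀ : ℝ) (hx₀ : Irrational x₀) :
    (∀ α : ℝ, 3/4 < α →
      Filter.limsup
        (fun x : ℝ => ((|x - x₀| ^ (-α) * |g x - g x₀| : ℝ) : EReal))
        (𝓝[≠] x₀) = ⊤) ∧
    ¬ DifferentiableAt ℝ g x₀ := by
  refine ⟨fun α hα ↦ ?_, fun hd ↦ ?_⟩
  · by_contra hne
    obtain ⟨M, hM, -⟩ := EReal.lt_iff_exists_real_btwn.mp (lt_top_iff_ne_top.mpr hne)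
    refine not_eventually_abs_g_sub_le hx₀ hα M ?_
    filter_upwards [eventually_lt_of_limsup_lt hM, self_mem_nhdsWithin] with x hx hxne
    have hpos : 0 < |x - x₀| := abs_pos.mpr (sub_ne_zero.mpr hxne)
    have h := (EReal.coe_lt_coe_iff.mp hx).le
    rwa [Real.rpow_neg hpos.le, inv_mul_le_iff₀ (by positivity), mul_comm] at h
  · obtain ⟨C, hC⟩ := hd.hasFDerivAt.isBigO_sub.bound
    refine not_eventually_abs_g_sub_le hx₀ (α := 1) (by norm_num) C ?_
    refine eventually_nhdsWithin_of_eventually_nhds ?_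
    simpa using hC
end

section
/- Let χ : ℤ → ℤ be defined by χ(n) = 1 if n ≡ 1 or 11 (mod 12), χ(n) = −1 if n ≡ 5 or 7 (mod 12), and χ(n) = 0 otherwise, and let h : ℝ → ℂ be defined by h(x) = ∑_{n=1}^∞ χ(n) n^{−2} e(n²x/24). Then h is differentiable at every rational number r, with h'(r) = 0. -/
open Complex Filter

/-- The even primitive Dirichlet character modulo 12 (the Kronecker symbol `(12/·)`). -/
def χ (n : ℤ) : ℤ :=
  if n % 12 = 1 ∨ n % 12 = 11 then 1
  else if n % 12 = 5 ∨ n % 12 = 7 then -1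
  else 0

/-- The (normalized) antiderivative of the boundary distribution of the Dedekind
eta function: `h(x) = ∑_{n ≥ 1} χ(n) n⁻² e(n²x/24)`.
(The `n = 0` term of the `tsum` vanishes, since `χ 0 = 0`.) -/
noncomputable def h (x : ℝ) : ℂ :=
  ∑' n : ℕ, (χ (n : ℤ) : ℂ) / (n : ℂ) ^ 2 * e ((n : ℝ) ^ 2 * x / 24)

/-- Exponential decay beats the power `x ^ (-3/4)`. -/
lemma exp_neg_le_rpow {x : ℝ} (hx : 0 < x) : Real.exp (-x) ≤ x ^ (-(3 / 4) : ℝ) := by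
  rw [Real.exp_neg, Real.rpow_neg hx.le]
  refine inv_anti₀ (by positivity) ?_
  calc x ^ (3 / 4 : ℝ) ≤ Real.exp x ^ (3 / 4 : ℝ) := by
        gcongr
        linarith [Real.add_one_le_exp x]
    _ ≤ Real.exp x := Real.rpow_le_self_of_one_le (Real.one_le_exp hx.le) (by norm_num)

lemma norm_dual_gaussian_term_le {b : ℂ} (hb : 0 < b.re) (x : ℝ) {n : ℤ} (hn : n ≠ 0) :
    ‖cexp (-Real.pi * b * n ^ 2 + 2 * Real.pi * (-I * x) * n)‖
      ≤ b.re ^ (-(3 / 4) : ℝ) * |(n : ℝ)| ^ (-(3 / 2) : ℝ) := by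
  have hn' : 0 < |(n : ℝ)| := by positivity
  have hre : (-Real.pi * b * n ^ 2 + 2 * Real.pi * (-I * x) * n : ℂ).re
      = -(Real.pi * (b.re * |(n : ℝ)| ^ 2)) := by
    have : (-Real.pi * b * n ^ 2 + 2 * Real.pi * (-I * x) * n : ℂ)
        = ((-Real.pi * (n : ℝ) ^ 2 : ℝ) : ℂ) * b + ((-2 * Real.pi * x * n : ℝ) : ℂ) * I := by
      push_cast; ring
    rw [this, add_re, re_ofReal_mul, re_ofReal_mul, I_re, sq_abs]
    ring
  rw [norm_exp, hre]
  have hpos : 0 < b.re * |(n : ℝ)| ^ 2 := by positivity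
  calc Real.exp (-(Real.pi * (b.re * |(n : ℝ)| ^ 2))) ≤ Real.exp (-(b.re * |(n : ℝ)| ^ 2)) := by
        exact Real.exp_le_exp.2 (by nlinarith [Real.pi_gt_three])
    _ ≤ (b.re * |(n : ℝ)| ^ 2) ^ (-(3 / 4) : ℝ) := exp_neg_le_rpow hpos
    _ = _ := by
        rw [Real.mul_rpow hb.le (by positivity), ← Real.rpow_natCast, ← Real.rpow_mul hn'.le]
        norm_num

/-- Poisson summation for shifted Gaussians: the main term does not depend on the shift. -/
lemma exists_norm_tsum_shifted_gaussian_sub_le :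
    ∃ K : ℝ, 0 ≤ K ∧ ∀ a : ℂ, 0 < a.re → ∀ x : ℝ,
      ‖∑' m : ℤ, cexp (-Real.pi * a * (m + x) ^ 2) - (1 / a) ^ (1 / 2 : ℂ)‖
        ≤ K * ‖a‖ ^ (-(1 / 2) : ℝ) * (1 / a).re ^ (-(3 / 4) : ℝ) := by
  have hs : Summable fun n : ℤ => |(n : ℝ)| ^ (-(3 / 2) : ℝ) :=
    Real.summable_abs_int_rpow (by norm_num)
  refine ⟨∑' n : ℤ, |(n : ℝ)| ^ (-(3 / 2) : ℝ), tsum_nonneg fun n => by positivity, ?_⟩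
  intro a ha x
  have ha0 : a ≠ 0 := fun h0 => by simp [h0] at ha
  have hb : 0 < (1 / a).re := by
    rw [one_div, inv_re]
    exact div_pos ha (normSq_pos.2 ha0)
  set F : ℤ → ℂ := fun n => cexp (-Real.pi * (1 / a) * n ^ 2 + 2 * Real.pi * (-I * x) * n) with hF
  have hbound : ∀ n : ℤ, ‖if n = 0 then 0 else F n‖
      ≤ (1 / a).re ^ (-(3 / 4) : ℝ) * |(n : ℝ)| ^ (-(3 / 2) : ℝ) := by
    intro n
    split_ifs with hn
    · rw [norm_zero]; positivity
    · exact norm_dual_gaussian_term_le hb x hn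
  have hs' := hs.mul_left ((1 / a).re ^ (-(3 / 4) : ℝ))
  have hsF : Summable F := by
    refine Summable.of_norm_bounded_eventually hs' ?_
    filter_upwards [(Set.finite_singleton (0 : ℤ)).compl_mem_cofinite] with n hn
    exact norm_dual_gaussian_term_le hb x hn
  have key := Complex.tsum_exp_neg_quadratic hb (-I * x)
  have h1 : ∀ n : ℤ, cexp (-Real.pi / (1 / a) * (n + I * (-I * x)) ^ 2)
      = cexp (-Real.pi * a * (n + x) ^ 2) := by
    intro n
    congr 1
    have : I * (-I * x) = x := by
      rw [← mul_assoc, mul_neg, I_mul_I]; ring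
    rw [this, div_div_eq_mul_div, div_one]
  simp_rw [h1] at key
  have hsq : (1 / a) ^ (1 / 2 : ℂ) ≠ 0 := by
    rw [Ne, cpow_eq_zero_iff]
    simp [ha0]
  have h2 : ∑' m : ℤ, cexp (-Real.pi * a * (m + x) ^ 2) = (1 / a) ^ (1 / 2 : ℂ) * ∑' n, F n := by
    rw [hF, key]
    field_simp
  rw [h2, hsF.tsum_eq_add_tsum_ite 0]
  have hF0 : F 0 = 1 := by simp [hF]
  rw [hF0, mul_add, mul_one, add_sub_cancel_left, norm_mul]
  have h3 : ‖(1 / a) ^ (1 / 2 : ℂ)‖ = ‖a‖ ^ (-(1 / 2) : ℝ) := by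
    have : (1 / 2 : ℂ) = ((1 / 2 : ℝ) : ℂ) := by push_cast; rfl
    rw [this, Complex.norm_cpow_real, one_div, norm_inv, Real.inv_rpow (norm_nonneg _),
      Real.rpow_neg (norm_nonneg _)]
  rw [h3]
  have h4 := tsum_of_norm_bounded hs'.hasSum hbound
  rw [tsum_mul_left] at h4
  calc _ ≤ ‖a‖ ^ (-(1 / 2) : ℝ) *
        ((1 / a).re ^ (-(3 / 4) : ℝ) * ∑' n : ℤ, |(n : ℝ)| ^ (-(3 / 2) : ℝ)) := by gcongr
    _ = _ := by ring

/-- A theta series whose coefficients are periodic with mean zero is small at the cusp `0`. -/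
lemma exists_norm_tsum_periodic_gaussian_le {N : ℕ} [NeZero N] {c : ℤ → ℂ}
    (hper : Function.Periodic c N) (hmean : ∑ j : Fin N, c (j : ℕ) = 0) :
    ∃ K : ℝ, 0 ≤ K ∧ ∀ a : ℂ, 0 < a.re →
      Summable (fun n : ℤ => c n * cexp (-Real.pi * a * n ^ 2)) →
      ‖∑' n : ℤ, c n * cexp (-Real.pi * a * n ^ 2)‖
        ≤ K * ‖a‖ ^ (-(1 / 2) : ℝ) * (1 / a).re ^ (-(3 / 4) : ℝ) := by
  obtain ⟨K, hK, hbd⟩ := exists_norm_tsum_shifted_gaussian_sub_le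
  have hN : (0 : ℝ) < N := by exact_mod_cast Nat.pos_of_ne_zero (NeZero.ne N)
  have hNc : (N : ℂ) ≠ 0 := by exact_mod_cast hN.ne'
  set M : ℝ := ((N : ℝ) ^ 2) ^ (-(1 / 2) : ℝ) * (((N : ℝ) ^ 2)⁻¹) ^ (-(3 / 4) : ℝ) with hM
  refine ⟨(∑ j : Fin N, ‖c (j : ℕ)‖) * K * M, by positivity, ?_⟩
  intro a ha hsum
  have ha0 : a ≠ 0 := fun h0 => by simp [h0] at ha
  set A : ℂ := ((N : ℝ) ^ 2 : ℝ) * a with hA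
  have hAre : 0 < A.re := by rw [hA, re_ofReal_mul]; positivity
  set E : Fin N × ℤ ≃ ℤ := (Equiv.prodComm _ _).trans (Int.divModEquiv N).symm with hE
  have hEv : ∀ p : Fin N × ℤ, E p = p.2 * N + ((p.1 : ℕ) : ℤ) := fun p => rfl
  have hterm : ∀ (j : Fin N) (m : ℤ), c (E (j, m)) * cexp (-Real.pi * a * (E (j, m) : ℤ) ^ 2)
      = c (j : ℕ) * cexp (-Real.pi * A * (m + ((j / N : ℝ) : ℂ)) ^ 2) := by
    intro j m
    rw [hEv]
    congr 1
    · rw [add_comm]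
      exact hper.int_mul m _
    · congr 1
      rw [hA]
      push_cast
      field_simp
  have hdecomp : ∑' n : ℤ, c n * cexp (-Real.pi * a * n ^ 2)
      = ∑ j : Fin N, c (j : ℕ) * (∑' m : ℤ, cexp (-Real.pi * A * (m + ((j / N : ℝ) : ℂ)) ^ 2)
          - (1 / A) ^ (1 / 2 : ℂ)) := by
    have hE' := (E.summable_iff.2 hsum).tsum_prod
    simp only [Function.comp_apply] at hE'
    rw [← E.tsum_eq, hE', tsum_fintype]
    simp_rw [hterm, tsum_mul_left, mul_sub]
    rw [Finset.sum_sub_distrib, ← Finset.sum_mul, hmean, zero_mul, sub_zero]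
  have hnormA : ‖A‖ = (N : ℝ) ^ 2 * ‖a‖ := by
    rw [hA, norm_mul, norm_real, Real.norm_of_nonneg (by positivity)]
  have hinvA : (1 / A).re = ((N : ℝ) ^ 2)⁻¹ * (1 / a).re := by
    rw [hA, one_div, mul_inv, ← ofReal_inv, re_ofReal_mul, one_div]
  have hinva : 0 ≤ (1 / a).re := by
    rw [one_div, inv_re]
    exact div_nonneg ha.le (normSq_nonneg _)
  rw [hdecomp]
  calc _ ≤ ∑ j : Fin N, ‖c (j : ℕ)‖ *
          (K * ‖A‖ ^ (-(1 / 2) : ℝ) * (1 / A).re ^ (-(3 / 4) : ℝ)) := by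
        refine norm_sum_le_of_le _ fun j _ => ?_
        rw [norm_mul]
        gcongr
        exact hbd A hAre _
    _ = _ := by
        rw [← Finset.sum_mul, hnormA, hinvA, Real.mul_rpow (by positivity) (norm_nonneg _),
          Real.mul_rpow (by positivity) hinva, hM]
        ring

lemma e_add_intCast (x : ℝ) (k : ℤ) : e (x + k) = e x := by
  unfold e
  rw [Complex.exp_eq_exp_iff_exists_int]
  exact ⟨k, by push_cast; ring⟩

/-- Modulo `24 q` there is a square root of `1` on which `χ` takes the value `-1`. -/
lemma exists_sq_modEq_one {q : ℕ} (hq : q ≠ 0) :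
    ∃ u : ℕ, u * u ≡ 1 [MOD 24 * q] ∧ u % 12 = 5 := by
  obtain ⟨k, M, hM, hkM⟩ :=
    Nat.exists_eq_pow_mul_and_not_dvd (n := 24 * q) (by omega) 3 (by norm_num)
  have hcop3 : Nat.Coprime 3 M := (Nat.Prime.coprime_iff_not_dvd Nat.prime_three).2 hM
  have hk : k ≠ 0 := by
    rintro rfl
    omega
  have h4 : 4 ∣ M := by
    have h4' : 4 ∣ 3 ^ k * M := ⟨6 * q, by omega⟩
    exact (Nat.Coprime.pow_right k (by norm_num : Nat.Coprime 4 3)).dvd_of_dvd_mul_left h4'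
  obtain ⟨u, hu1, hu2⟩ := Nat.chineseRemainder (hcop3.pow_left k) (3 ^ k - 1) 1
  have h3k : 1 ≤ 3 ^ k := Nat.one_le_pow _ _ (by norm_num)
  have d1 : ((3 ^ k : ℕ) : ℤ) ∣ u + 1 := by
    have := (Nat.modEq_iff_dvd.1 hu1.symm)
    rw [Nat.cast_sub h3k] at this
    have hdvd := dvd_add this (dvd_refl ((3 ^ k : ℕ) : ℤ))
    rwa [Nat.cast_one, sub_sub_eq_add_sub, sub_add_cancel] at hdvd
  have d2 : (M : ℤ) ∣ u - 1 := by exact_mod_cast Nat.modEq_iff_dvd.1 hu2.symm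
  refine ⟨u, ?_, ?_⟩
  · rw [hkM]
    refine (Nat.modEq_iff_dvd.2 ?_).symm
    have := mul_dvd_mul d1 d2
    push_cast at this ⊢
    rwa [show (u * u - 1 : ℤ) = (u + 1) * (u - 1) by ring]
  · have e3 : (3 : ℤ) ∣ u + 1 :=
      (by exact_mod_cast dvd_pow_self 3 hk : (3 : ℤ) ∣ (3 ^ k : ℕ)).trans d1
    have e4 : (4 : ℤ) ∣ u - 1 := (by exact_mod_cast h4 : (4 : ℤ) ∣ M).trans d2
    omega

lemma χ_neg (n : ℤ) : χ (-n) = χ n := by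
  unfold χ
  split_ifs <;> omega

lemma χ_add_twelve_mul (n k : ℤ) : χ (n + 12 * k) = χ n := by
  unfold χ
  rw [Int.add_mul_emod_self_left]

lemma χ_mul_of_emod_eq_five {u : ℤ} (hu : u % 12 = 5) (n : ℤ) : χ (u * n) = -χ n := by
  unfold χ
  rw [Int.mul_emod, hu]
  have h0 := Int.emod_nonneg n (by norm_num : (12 : ℤ) ≠ 0)
  have h12 := Int.emod_lt_of_pos n (by norm_num : (0 : ℤ) < 12)
  generalize n % 12 = m at *
  interval_cases m <;> simp

lemma norm_χ_le (n : ℤ) : ‖(χ n : ℂ)‖ ≤ 1 := by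
  unfold χ
  split_ifs <;> simp

lemma norm_e (x : ℝ) : ‖e x‖ = 1 := by
  unfold e
  rw [show (2 * Real.pi * I * x : ℂ) = ((2 * Real.pi * x : ℝ) : ℂ) * I by push_cast; ring]
  exact norm_exp_ofReal_mul_I _

/-- The Fourier coefficients of `h` after translating the rational `r` to `0`. -/
noncomputable def twistedχ (r : ℚ) (n : ℤ) : ℂ := χ n * e ((n : ℝ) ^ 2 * r / 24)

lemma twistedχ_zero (r : ℚ) : twistedχ r 0 = 0 := by simp [twistedχ, χ]

lemma twistedχ_neg (r : ℚ) (n : ℤ) : twistedχ r (-n) = twistedχ r n := by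
  simp [twistedχ, χ_neg]

lemma norm_twistedχ_le (r : ℚ) (n : ℤ) : ‖twistedχ r n‖ ≤ 1 := by
  rw [twistedχ, norm_mul, norm_e, mul_one]
  exact norm_χ_le n

lemma e_sq_mul_congr (r : ℚ) {m n : ℤ} (k : ℤ) (hk : m ^ 2 = n ^ 2 + 24 * r.den * k) :
    e ((m : ℝ) ^ 2 * r / 24) = e ((n : ℝ) ^ 2 * r / 24) := by
  have hm : (m : ℝ) ^ 2 = (n : ℝ) ^ 2 + 24 * r.den * k := by exact_mod_cast hk
  have hr : (r.den : ℝ) * r = r.num := by exact_mod_cast Rat.den_mul_eq_num r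
  rw [← e_add_intCast ((n : ℝ) ^ 2 * r / 24) (k * r.num), hm]
  congr 1
  push_cast
  rw [← hr]
  ring

lemma twistedχ_periodic (r : ℚ) : Function.Periodic (twistedχ r) ((24 * r.den : ℕ) : ℤ) := by
  intro n
  unfold twistedχ
  congr 1
  · rw [show n + ((24 * r.den : ℕ) : ℤ) = n + 12 * (2 * r.den) by push_cast; ring,
      χ_add_twelve_mul]
  · exact e_sq_mul_congr r (2 * n + 24 * r.den) (by push_cast; ring)

lemma twistedχ_sum_eq_zero (r : ℚ) : ∑ j : Fin (24 * r.den), twistedχ r (j : ℕ) = 0 := by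
  obtain ⟨u, hu, hu12⟩ := exists_sq_modEq_one r.den_ne_zero
  have hN : 0 < 24 * r.den := by have := r.den_pos; omega
  have hflip : ∀ n : ℤ, twistedχ r (u * n) = -twistedχ r n := by
    intro n
    obtain ⟨k, hk⟩ := Nat.modEq_iff_dvd.1 hu.symm
    unfold twistedχ
    rw [χ_mul_of_emod_eq_five (by omega), e_sq_mul_congr r (n := n) (k * n ^ 2)]
    · push_cast; ring
    · push_cast at hk
      linear_combination n ^ 2 * hk
  have hmod : ∀ n : ℕ, twistedχ r ((n % (24 * r.den) : ℕ) : ℤ) = twistedχ r n := by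
    intro n
    have := (twistedχ_periodic r).int_mul (n / (24 * r.den) : ℕ) ((n % (24 * r.den) : ℕ) : ℤ)
    rw [← this]
    rw [Int.cast_natCast, ← Nat.cast_mul, ← Nat.cast_add, Nat.mod_add_div']
  have hgval : ∀ j : Fin (24 * r.den), twistedχ r ((u * j % (24 * r.den) : ℕ) : ℤ)
      = -twistedχ r (j : ℕ) := by
    intro j
    rw [hmod, Nat.cast_mul, hflip]
  refine Finset.sum_involution (fun j _ => ⟨u * j % (24 * r.den), Nat.mod_lt _ hN⟩) ?_ ?_ ?_ ?_
  · intro j _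
    rw [hgval, add_neg_cancel]
  · intro j _ hj hfix
    have := hgval j
    rw [show u * (j : ℕ) % (24 * r.den) = j from congrArg Fin.val hfix] at this
    exact hj (self_eq_neg.1 this)
  · intro j _
    exact Finset.mem_univ _
  · intro j _
    ext
    have h1 : u * (u * j % (24 * r.den)) ≡ u * (u * j) [MOD 24 * r.den] :=
      (Nat.mod_modEq _ _).mul_left u
    have h2 : u * (u * j) ≡ 1 * j [MOD 24 * r.den] := by
      rw [← mul_assoc]; exact hu.mul_right _
    have h3 := h1.trans h2
    rw [one_mul] at h3
    exact Eq.trans h3 (Nat.mod_eq_of_lt j.2)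

/-- The two-sided theta-type series whose boundary values give the antiderivative of a weight `1/2`
boundary distribution. -/
noncomputable def thetaPrimitive (c : ℤ → ℂ) (z : ℂ) : ℂ :=
  ∑' n : ℤ, c n / (n : ℂ) ^ 2 * cexp (2 * Real.pi * I * ((n : ℂ) ^ 2 * z / 24))

lemma norm_thetaPrimitive_term_le {c : ℤ → ℂ} (hc : ∀ n, ‖c n‖ ≤ 1) (n : ℤ) {z : ℂ}
    (hz : 0 ≤ z.im) :
    ‖c n / (n : ℂ) ^ 2 * cexp (2 * Real.pi * I * ((n : ℂ) ^ 2 * z / 24))‖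
      ≤ 1 / (n : ℝ) ^ 2 := by
  have hexp : ‖cexp (2 * Real.pi * I * ((n : ℂ) ^ 2 * z / 24))‖ ≤ 1 := by
    rw [norm_exp, Real.exp_le_one_iff]
    have : (2 * Real.pi * I * ((n : ℂ) ^ 2 * z / 24))
        = ((2 * Real.pi * (n : ℝ) ^ 2 / 24 : ℝ) : ℂ) * (I * z) := by push_cast; ring
    rw [this, re_ofReal_mul, I_mul_re]
    exact mul_nonpos_of_nonneg_of_nonpos (by positivity) (by linarith)
  have hn : ‖(n : ℂ) ^ 2‖ = (n : ℝ) ^ 2 := by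
    rw [norm_pow, Complex.norm_intCast, sq_abs]
  rw [norm_mul, norm_div, hn]
  calc ‖c n‖ / (n : ℝ) ^ 2 * _ ≤ 1 / (n : ℝ) ^ 2 * 1 := by
        gcongr
        exact hc n
    _ = _ := mul_one _

lemma summable_one_div_int_sq : Summable fun n : ℤ => 1 / (n : ℝ) ^ 2 :=
  Real.summable_one_div_int_pow.2 (by norm_num)

lemma continuousOn_thetaPrimitive {c : ℤ → ℂ} (hc : ∀ n, ‖c n‖ ≤ 1) :
    ContinuousOn (thetaPrimitive c) {z | 0 ≤ z.im} :=
  continuousOn_tsum (fun n => by fun_prop) summable_one_div_int_sq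
    fun n _ hz => norm_thetaPrimitive_term_le hc n hz

lemma differentiableAt_thetaPrimitive {c : ℤ → ℂ} (hc : ∀ n, ‖c n‖ ≤ 1) {z : ℂ}
    (hz : 0 < z.im) : DifferentiableAt ℂ (thetaPrimitive c) z :=
  (Complex.differentiableOn_tsum_of_summable_norm summable_one_div_int_sq
    (fun n => by fun_prop) UpperHalfPlane.isOpen_upperHalfPlaneSet
    fun n _ hw => norm_thetaPrimitive_term_le hc n (le_of_lt hw)).differentiableAt
    (UpperHalfPlane.isOpen_upperHalfPlaneSet.mem_nhds hz)

lemma hasSum_deriv_thetaPrimitive {c : ℤ → ℂ} (hc : ∀ n, ‖c n‖ ≤ 1) (hc0 : c 0 = 0) {z : ℂ}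
    (hz : 0 < z.im) :
    HasSum (fun n : ℤ => Real.pi * I / 12 * (c n * cexp (-Real.pi * (-I * z / 12) * n ^ 2)))
      (deriv (thetaPrimitive c) z) := by
  have hsum := Complex.hasSum_deriv_of_summable_norm
    (F := fun (n : ℤ) z => c n / (n : ℂ) ^ 2 * cexp (2 * Real.pi * I * ((n : ℂ) ^ 2 * z / 24)))
    summable_one_div_int_sq (fun n => by fun_prop) UpperHalfPlane.isOpen_upperHalfPlaneSet
    (fun n _ hw => norm_thetaPrimitive_term_le hc n (le_of_lt hw)) hz
  refine Eq.subst (motive := fun f => HasSum f (deriv (thetaPrimitive c) z))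
    (funext fun n => ?_) hsum
  have hexp : HasDerivAt (fun z : ℂ => 2 * Real.pi * I * ((n : ℂ) ^ 2 * z / 24))
      (2 * Real.pi * I * ((n : ℂ) ^ 2 * 1 / 24)) z :=
    ((((hasDerivAt_id z).const_mul _).div_const _).const_mul _)
  rw [(hexp.cexp.const_mul (c n / (n : ℂ) ^ 2)).deriv]
  rcases eq_or_ne n 0 with rfl | hn
  · simp [hc0]
  · have hn' : (n : ℂ) ≠ 0 := by exact_mod_cast hn
    rw [show (-Real.pi * (-I * z / 12) * n ^ 2 : ℂ)
      = 2 * Real.pi * I * ((n : ℂ) ^ 2 * z / 24) by ring]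
    field_simp
    ring

/-- Cuspidality bound for the derivative of the theta primitive near the cusp `0`. -/
lemma exists_norm_deriv_thetaPrimitive_le {N : ℕ} [NeZero N] {c : ℤ → ℂ} (hc : ∀ n, ‖c n‖ ≤ 1)
    (hc0 : c 0 = 0) (hper : Function.Periodic c N) (hmean : ∑ j : Fin N, c (j : ℕ) = 0) :
    ∃ C : ℝ, 0 ≤ C ∧ ∀ z : ℂ, 0 < z.im →
      ‖deriv (thetaPrimitive c) z‖ ≤ C * ‖z‖ * z.im ^ (-(3 / 4) : ℝ) := by
  obtain ⟨K, hK, hbd⟩ := exists_norm_tsum_periodic_gaussian_le hper hmean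
  refine ⟨Real.pi / 12 * K * (1 / 12 : ℝ) ^ (-(1 / 2) : ℝ) * (12 : ℝ) ^ (-(3 / 4) : ℝ),
    by positivity, ?_⟩
  intro z hz
  have hz0 : z ≠ 0 := fun h0 => by simp [h0] at hz
  have hnz : 0 < ‖z‖ := norm_pos_iff.2 hz0
  have hsum := hasSum_deriv_thetaPrimitive hc hc0 hz
  have hpi : (Real.pi * I / 12 : ℂ) ≠ 0 := by simp [Real.pi_ne_zero]
  have ha : (-I * z / 12) = ((1 / 12 : ℝ) : ℂ) * (-I * z) := by push_cast; ring
  have hIre : (-I * z).re = z.im := by simp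
  have hare : 0 < (-I * z / 12).re := by
    rw [ha, re_ofReal_mul, hIre]; positivity
  have hna : ‖-I * z / 12‖ = 1 / 12 * ‖z‖ := by
    rw [ha, norm_mul, norm_real, norm_mul, norm_neg, norm_I, one_mul]
    norm_num
  have hinv : (1 / (-I * z / 12)).re = 12 * (z.im * ‖z‖ ^ (-2 : ℝ)) := by
    rw [one_div, inv_re, normSq_eq_norm_sq, hna, ha, re_ofReal_mul, hIre,
      Real.rpow_neg hnz.le, Real.rpow_two]
    field_simp
  have hb := hbd _ hare ((summable_mul_left_iff hpi).1 hsum.summable)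
  rw [← hsum.tsum_eq, tsum_mul_left, norm_mul]
  have hnpi : ‖(Real.pi * I / 12 : ℂ)‖ = Real.pi / 12 := by
    simp [abs_of_pos Real.pi_pos]
  rw [hnpi]
  rw [hna, hinv, Real.mul_rpow (by norm_num) hnz.le, Real.mul_rpow (by norm_num) (by positivity),
    Real.mul_rpow hz.le (by positivity), ← Real.rpow_mul hnz.le] at hb
  have hpow : ‖z‖ ^ (-(1 / 2) : ℝ) * ‖z‖ ^ (-2 * -(3 / 4) : ℝ) = ‖z‖ := by
    rw [← Real.rpow_add hnz]
    norm_num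
  refine (mul_le_mul_of_nonneg_left hb (by positivity)).trans_eq ?_
  calc _ = Real.pi / 12 * K * (1 / 12 : ℝ) ^ (-(1 / 2) : ℝ) * (12 : ℝ) ^ (-(3 / 4) : ℝ)
        * (‖z‖ ^ (-(1 / 2) : ℝ) * ‖z‖ ^ (-2 * -(3 / 4) : ℝ)) * z.im ^ (-(3 / 4) : ℝ) := by ring
    _ = _ := by rw [hpow]

section BoundaryDerivative

variable {G : ℂ → ℂ} {C : ℝ}

lemma norm_add_mul_I_le {x y T : ℝ} (hx : |x| ≤ T) (hy : |y| ≤ T) : ‖(x + y * I : ℂ)‖ ≤ 2 * T := by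
  calc ‖(x + y * I : ℂ)‖ ≤ ‖(x : ℂ)‖ + ‖(y * I : ℂ)‖ := norm_add_le _ _
    _ = |x| + |y| := by simp
    _ ≤ 2 * T := by linarith

lemma norm_sub_le_of_vertical_segment (hC : 0 ≤ C) (hcont : ContinuousOn G {z | 0 ≤ z.im})
    (hdiff : ∀ z : ℂ, 0 < z.im → DifferentiableAt ℂ G z)
    (hbd : ∀ z : ℂ, 0 < z.im → ‖deriv G z‖ ≤ C * ‖z‖ * z.im ^ (-(3 / 4) : ℝ))
    {x T : ℝ} (hT : 0 ≤ T) (hx : |x| ≤ T) :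
    ‖G x - G (x + T * I)‖ ≤ 8 * C * T * T ^ (1 / 4 : ℝ) := by
  have hcurve : ∀ s : ℝ, HasDerivAt (fun s : ℝ => (x + ((T - s : ℝ) : ℂ) * I : ℂ)) (-I) s := by
    intro s
    have h1 : HasDerivAt (fun s : ℝ => ((T - s : ℝ) : ℂ)) (((-1 : ℝ)) : ℂ) s :=
      ((hasDerivAt_id s).const_sub T).ofReal_comp
    simpa using (h1.mul_const I).const_add (x : ℂ)
  have him : ∀ s : ℝ, (x + ((T - s : ℝ) : ℂ) * I : ℂ).im = T - s := by intro s; simp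
  have hbound := image_norm_le_of_norm_deriv_right_le_deriv_boundary' (a := 0) (b := T)
    (f := fun s : ℝ => G (x + ((T - s : ℝ) : ℂ) * I) - G (x + T * I))
    (f' := fun s => deriv G (x + ((T - s : ℝ) : ℂ) * I) * -I)
    (B := fun s => 8 * C * T * (T ^ (1 / 4 : ℝ) - (T - s) ^ (1 / 4 : ℝ)))
    (B' := fun s => C * (2 * T) * (T - s) ^ (-(3 / 4) : ℝ)) ?_ ?_ ?_ ?_ ?_ ?_
    (Set.right_mem_Icc.2 hT)
  · simpa using hbound
  · refine ContinuousOn.sub ?_ continuousOn_const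
    refine hcont.comp (f := fun s : ℝ => (x + ((T - s : ℝ) : ℂ) * I : ℂ))
      (fun s _ => (hcurve s).continuousAt.continuousWithinAt) fun s hs => ?_
    simp only [Set.mem_ofPred_eq, him]
    linarith [hs.2]
  · intro s hs
    have hpos : 0 < (x + ((T - s : ℝ) : ℂ) * I : ℂ).im := by rw [him]; linarith [hs.2]
    exact (((hdiff _ hpos).hasDerivAt.comp s (hcurve s)).sub_const _).hasDerivWithinAt
  · simp
  · refine ContinuousOn.mul continuousOn_const (continuousOn_const.sub ?_)
    exact ContinuousOn.rpow_const (by fun_prop) fun s _ => Or.inr (by norm_num)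
  · intro s hs
    have hpos : T - s ≠ 0 := by linarith [hs.2]
    have h1 := (((((hasDerivAt_id s).const_sub T).rpow_const (p := 1 / 4) (Or.inl hpos)).const_sub
      (T ^ (1 / 4 : ℝ))).const_mul (8 * C * T)).hasDerivWithinAt (s := Set.Ici s)
    refine h1.congr_deriv ?_
    norm_num
    ring
  · intro s hs
    have hpos : 0 < (x + ((T - s : ℝ) : ℂ) * I : ℂ).im := by rw [him]; linarith [hs.2]
    have h1 := hbd _ hpos
    rw [him] at h1
    rw [norm_mul, norm_neg, norm_I, mul_one]
    refine h1.trans ?_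
    have h2 : 0 ≤ T - s := by linarith [hs.2]
    gcongr
    exact norm_add_mul_I_le hx (by rw [abs_of_nonneg h2]; linarith [hs.1])

lemma norm_sub_le_of_horizontal_segment (hC : 0 ≤ C)
    (hdiff : ∀ z : ℂ, 0 < z.im → DifferentiableAt ℂ G z)
    (hbd : ∀ z : ℂ, 0 < z.im → ‖deriv G z‖ ≤ C * ‖z‖ * z.im ^ (-(3 / 4) : ℝ))
    {x T : ℝ} (hT : 0 < T) (hx : |x| ≤ T) :
    ‖G (x + T * I) - G (T * I)‖ ≤ 2 * C * T * T ^ (1 / 4 : ℝ) := by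
  have him : ∀ s : ℝ, (s + T * I : ℂ).im = T := by intro s; simp
  have hcurve : ∀ s : ℝ, HasDerivAt (fun s : ℝ => (s + T * I : ℂ)) 1 s := by
    intro s
    simpa using (hasDerivAt_id s).ofReal_comp.add_const (T * I : ℂ)
  have hbound := Convex.norm_image_sub_le_of_norm_hasDerivWithin_le
    (f := fun s : ℝ => G (s + T * I)) (f' := fun s => deriv G (s + T * I) * 1)
    (s := Set.Icc (-T) T) (x := 0) (y := x) (C := C * (2 * T) * T ^ (-(3 / 4) : ℝ))
    ?_ ?_ (convex_Icc _ _) ⟨by linarith, hT.le⟩ (abs_le.1 hx)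
  · simp only [ofReal_zero, zero_add, sub_zero, Real.norm_eq_abs] at hbound
    refine hbound.trans ?_
    calc _ ≤ C * (2 * T) * T ^ (-(3 / 4) : ℝ) * T := by gcongr
      _ = 2 * C * T * (T ^ (-(3 / 4) : ℝ) * T) := by ring
      _ = _ := by
        rw [← Real.rpow_add_one hT.ne']
        norm_num
  · intro s _
    have hpos : 0 < (s + T * I : ℂ).im := by rwa [him]
    exact ((hdiff _ hpos).hasDerivAt.comp s (hcurve s)).hasDerivWithinAt
  · intro s hs
    have h1 := hbd (s + T * I) (by rwa [him])
    rw [him] at h1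
    rw [mul_one]
    refine h1.trans ?_
    gcongr
    exact norm_add_mul_I_le (abs_le.2 hs) (abs_of_pos hT).le

/-- A cuspidal bound on the derivative in the upper half-plane forces the boundary values to have
vanishing derivative at `0`. -/
lemma hasDerivAt_zero_of_norm_deriv_le (hC : 0 ≤ C) (hcont : ContinuousOn G {z | 0 ≤ z.im})
    (hdiff : ∀ z : ℂ, 0 < z.im → DifferentiableAt ℂ G z)
    (hbd : ∀ z : ℂ, 0 < z.im → ‖deriv G z‖ ≤ C * ‖z‖ * z.im ^ (-(3 / 4) : ℝ)) :
    HasDerivAt (fun t : ℝ => G t) 0 0 := by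
  have hmain : ∀ t : ℝ, ‖G t - G 0‖ ≤ 18 * C * |t| ^ (1 / 4 : ℝ) * |t| := by
    intro t
    rcases eq_or_ne t 0 with rfl | ht
    · simp
    have hT : 0 < |t| := abs_pos.2 ht
    have h1 := norm_sub_le_of_vertical_segment hC hcont hdiff hbd hT.le le_rfl
    have h2 := norm_sub_le_of_horizontal_segment hC hdiff hbd hT le_rfl
    have h3 := norm_sub_le_of_vertical_segment hC hcont hdiff hbd (x := 0) hT.le (by simp)
    rw [ofReal_zero, zero_add, norm_sub_rev] at h3
    calc ‖G t - G 0‖ = ‖(G t - G (t + |t| * I)) + (G (t + |t| * I) - G (|t| * I))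
          + (G (|t| * I) - G 0)‖ := by congr 1; ring
      _ ≤ _ := norm_add₃_le
      _ ≤ 18 * C * |t| ^ (1 / 4 : ℝ) * |t| := by linarith
  rw [hasDerivAt_iff_isLittleO, Asymptotics.isLittleO_iff]
  intro ε hε
  have hlim : Tendsto (fun t : ℝ => 18 * C * |t| ^ (1 / 4 : ℝ)) (nhds 0) (nhds 0) := by
    have : ContinuousAt (fun t : ℝ => 18 * C * |t| ^ (1 / 4 : ℝ)) 0 :=
      continuousAt_const.mul (continuous_abs.continuousAt.rpow_const (Or.inr (by norm_num)))
    simpa [ContinuousAt] using this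
  filter_upwards [hlim.eventually_le_const hε] with t ht
  simp only [ofReal_zero, sub_zero, smul_zero, Real.norm_eq_abs]
  exact (hmain t).trans (by gcongr)

end BoundaryDerivative

lemma h_eq_thetaPrimitive (r : ℚ) (t : ℝ) :
    h (r + t) = 1 / 2 * thetaPrimitive (twistedχ r) t := by
  have hsum : Summable fun n : ℤ => twistedχ r n / (n : ℂ) ^ 2
      * cexp (2 * Real.pi * I * ((n : ℂ) ^ 2 * t / 24)) :=
    Summable.of_norm_bounded summable_one_div_int_sq fun n =>
      norm_thetaPrimitive_term_le (norm_twistedχ_le r) n (by simp)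
  have hnat := hsum.hasSum.nat_add_neg.tsum_eq
  rw [thetaPrimitive]
  rw [Int.cast_zero, twistedχ_zero, zero_div, zero_mul, add_zero] at hnat
  rw [← hnat, ← tsum_mul_left, h]
  refine tsum_congr fun n => ?_
  rw [twistedχ_neg, Int.cast_neg, neg_sq, ← two_mul, ← mul_assoc, one_div,
    inv_mul_cancel₀ two_ne_zero, one_mul, twistedχ, Int.cast_natCast, Int.cast_natCast]
  have he : e ((n : ℝ) ^ 2 * (r + t) / 24)
      = e ((n : ℝ) ^ 2 * r / 24) * cexp (2 * Real.pi * I * ((n : ℂ) ^ 2 * t / 24)) := by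
    rw [e, e, ← Complex.exp_add]
    congr 1
    push_cast
    ring
  rw [he]
  ring

/-- `h` is differentiable at every rational point, with derivative zero. -/
theorem stmt_13 (r : ℚ) : HasDerivAt h 0 (r : ℝ) := by
  have : NeZero (24 * r.den) := ⟨by have := r.den_pos; omega⟩
  obtain ⟨C, hC, hbd⟩ := exists_norm_deriv_thetaPrimitive_le (norm_twistedχ_le r)
    (twistedχ_zero r) (twistedχ_periodic r) (twistedχ_sum_eq_zero r)
  have h0 := hasDerivAt_zero_of_norm_deriv_le hC (continuousOn_thetaPrimitive (norm_twistedχ_le r))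
    (fun z hz => differentiableAt_thetaPrimitive (norm_twistedχ_le r) hz) hbd
  rw [← sub_self (r : ℝ)] at h0
  have h1 := (h0.comp_sub_const (r : ℝ) (r : ℝ)).const_mul (1 / 2 : ℂ)
  rw [mul_zero] at h1
  refine h1.congr_of_eventuallyEq (Eventually.of_forall fun x => ?_)
  simpa using h_eq_thetaPrimitive r (x - r)
end
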